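/- arXiv:1901.07671 — 2 statements merged into one kernel-verified Lean document; each statement's English description precedes it below -/
import Mathlib

section
/- Let n ≥ 1 and let u be a non-constant solution of the Allen–Cahn equation −Δu = u − u³ on ℝⁿ. Assume u(x) < 0 for every x with xₙ < 0. Then there exists a real number a such that u(x) ≤ H(xₙ + a) for all x ∈ ℝⁿ, and moreover exactly one of the following holds: (1) u(x) = H(xₙ + a) for all x ∈ ℝⁿ; or (2) u(x) < H(xₙ + a) for all x ∈ ℝⁿ and there exists a sequence of points (y_k) in ℝ^{n−1}×{0} with |y_k| → +∞ such that the translated functions x ↦ u(x + y_k) converge, locally uniformly on ℝⁿ together with their first and second derivatives, to the function x ↦ H(xₙ + a). -/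
open scoped RealInnerProductSpace

noncomputable def laplacian {n : ℕ} (u : EuclideanSpace ℝ (Fin n) → ℝ)
    (x : EuclideanSpace ℝ (Fin n)) : ℝ :=
  ∑ i : Fin n, fderiv ℝ (fun y => fderiv ℝ u y (EuclideanSpace.single i 1)) x
    (EuclideanSpace.single i 1)

def IsACSolution {n : ℕ} (u : EuclideanSpace ℝ (Fin n) → ℝ) : Prop :=
  ContDiff ℝ 2 u ∧ ∀ x, -laplacian u x = u x - (u x) ^ 3

noncomputable def H (t : ℝ) : ℝ := Real.tanh (t / Real.sqrt 2)

section helpers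

open Filter Topology Metric

/-- Second derivative test (necessary condition) in one variable. -/
lemma sec_max {γ γ1 : ℝ → ℝ} {γ2 : ℝ} (hm : IsLocalMax γ 0)
    (h1 : ∀ᶠ t in 𝓝 (0:ℝ), HasDerivAt γ (γ1 t) t) (h2 : HasDerivAt γ1 γ2 0) : γ2 ≤ 0 := by
  by_contra hpos
  push Not at hpos
  have e1 : deriv γ =ᶠ[𝓝 0] γ1 := h1.mono fun t ht => ht.deriv
  have e2 : deriv (deriv γ) 0 = γ2 := by rw [e1.deriv_eq]; exact h2.deriv
  have hmin : IsLocalMin γ 0 := isLocalMin_of_deriv_deriv_pos (by rw [e2]; exact hpos)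
    hm.deriv_eq_zero h1.self_of_nhds.continuousAt
  have hc : γ =ᶠ[𝓝 0] fun _ => γ 0 := by
    filter_upwards [hm, hmin] with t a b using le_antisymm a b
  have e3 : deriv γ =ᶠ[𝓝 0] fun _ => 0 := by
    have := hc.deriv
    simpa using this
  have : deriv (deriv γ) 0 = 0 := by rw [e3.deriv_eq]; simp
  linarith

section basics
variable {n : ℕ}

lemma line_hasDerivAt (x v : EuclideanSpace ℝ (Fin n)) (t : ℝ) :
    HasDerivAt (fun t : ℝ => x + t • v) v t := by
  simpa using ((hasDerivAt_id t).smul_const v).const_add x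

lemma line1 {u : EuclideanSpace ℝ (Fin n) → ℝ} (hu : ContDiff ℝ 2 u)
    (x v : EuclideanSpace ℝ (Fin n)) (t : ℝ) :
    HasDerivAt (fun t : ℝ => u (x + t • v)) (fderiv ℝ u (x + t • v) v) t :=
  ((hu.differentiable (by norm_num)) (x + t • v)).hasFDerivAt.comp_hasDerivAt t
    (line_hasDerivAt x v t)

lemma diff_fderiv_apply {u : EuclideanSpace ℝ (Fin n) → ℝ} (hu : ContDiff ℝ 2 u)
    (v : EuclideanSpace ℝ (Fin n)) : Differentiable ℝ (fun y => fderiv ℝ u y v) := by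
  have h : ContDiff ℝ 1 (fderiv ℝ u) := hu.fderiv_right (by norm_num)
  exact (h.differentiable (by norm_num)).clm_apply (differentiable_const v)

lemma line2 {u : EuclideanSpace ℝ (Fin n) → ℝ} (hu : ContDiff ℝ 2 u)
    (x v : EuclideanSpace ℝ (Fin n)) :
    HasDerivAt (fun t : ℝ => fderiv ℝ u (x + t • v) v)
      (fderiv ℝ (fun y => fderiv ℝ u y v) x v) 0 := by
  have h := (diff_fderiv_apply hu v (x + (0:ℝ) • v)).hasFDerivAt.comp_hasDerivAt (0:ℝ)
    (line_hasDerivAt x v 0)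
  simpa [Function.comp_def] using h

/-- Compute the Laplacian along coordinate lines. -/
lemma laplacian_of_lines {u : EuclideanSpace ℝ (Fin n) → ℝ} (hu : ContDiff ℝ 2 u)
    (x : EuclideanSpace ℝ (Fin n)) (g1 : Fin n → ℝ → ℝ) (g2 : Fin n → ℝ)
    (h1 : ∀ i t, HasDerivAt (fun t : ℝ => u (x + t • EuclideanSpace.single i 1)) (g1 i t) t)
    (h2 : ∀ i, HasDerivAt (g1 i) (g2 i) 0) : laplacian u x = ∑ i, g2 i := by
  unfold laplacian
  refine Finset.sum_congr rfl fun i _ => ?_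
  have : g1 i = fun t : ℝ => fderiv ℝ u (x + t • EuclideanSpace.single i 1)
      (EuclideanSpace.single i 1) := by
    funext t
    exact (h1 i t).unique (line1 hu x _ t)
  have h := h2 i
  rw [this] at h
  exact (line2 hu x _).unique h

lemma laplacian_add {u v : EuclideanSpace ℝ (Fin n) → ℝ} (hu : ContDiff ℝ 2 u)
    (hv : ContDiff ℝ 2 v) (x) :
    laplacian (fun y => u y + v y) x = laplacian u x + laplacian v x := by
  rw [laplacian_of_lines (hu.add hv) x _ _ (fun i t => (line1 hu x _ t).add (line1 hv x _ t))
    (fun i => (line2 hu x _).add (line2 hv x _)), Finset.sum_add_distrib]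
  rfl

lemma laplacian_const_mul {u : EuclideanSpace ℝ (Fin n) → ℝ} (hu : ContDiff ℝ 2 u) (c : ℝ) (x) :
    laplacian (fun y => c * u y) x = c * laplacian u x := by
  rw [laplacian_of_lines (contDiff_const.mul hu) x _ _ (fun i t => (line1 hu x _ t).const_mul c)
    (fun i => (line2 hu x _).const_mul c), ← Finset.mul_sum]
  rfl

lemma laplacian_neg {u : EuclideanSpace ℝ (Fin n) → ℝ} (hu : ContDiff ℝ 2 u) (x) :
    laplacian (fun y => -u y) x = -laplacian u x := by
  have := laplacian_const_mul hu (-1) x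
  simpa using this

lemma laplacian_sub {u v : EuclideanSpace ℝ (Fin n) → ℝ} (hu : ContDiff ℝ 2 u)
    (hv : ContDiff ℝ 2 v) (x) :
    laplacian (fun y => u y - v y) x = laplacian u x - laplacian v x := by
  have := laplacian_add hu hv.neg x
  rw [laplacian_neg hv] at this
  simpa [sub_eq_add_neg] using this

lemma contDiff_translate {u : EuclideanSpace ℝ (Fin n) → ℝ} (hu : ContDiff ℝ 2 u)
    (h : EuclideanSpace ℝ (Fin n)) : ContDiff ℝ 2 (fun y => u (y + h)) :=
  hu.comp (contDiff_id.add contDiff_const)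

lemma laplacian_translate {u : EuclideanSpace ℝ (Fin n) → ℝ} (hu : ContDiff ℝ 2 u)
    (h x : EuclideanSpace ℝ (Fin n)) :
    laplacian (fun y => u (y + h)) x = laplacian u (x + h) := by
  rw [laplacian_of_lines (contDiff_translate hu h) x
    (fun i t => fderiv ℝ u (x + h + t • EuclideanSpace.single i 1) (EuclideanSpace.single i 1))
    _ (fun i t => ?_) (fun i => line2 hu (x + h) _)]
  · rfl
  · have := line1 hu (x + h) (EuclideanSpace.single i 1) t
    refine this.congr_of_eventuallyEq (Eventually.of_forall fun s => ?_)
    simp only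
    congr 1
    abel

lemma norm_line (p x0 : EuclideanSpace ℝ (Fin n)) (i : Fin n) (t : ℝ) :
    ‖p + t • EuclideanSpace.single i (1:ℝ) - x0‖ ^ 2 =
      ‖p - x0‖ ^ 2 + 2 * t * (p - x0) i + t ^ 2 := by
  have : p + t • EuclideanSpace.single i (1:ℝ) - x0
      = (p - x0) + t • EuclideanSpace.single i (1:ℝ) := by abel
  rw [this, norm_add_sq_real, norm_smul, inner_smul_right, EuclideanSpace.inner_single_right]
  simp
  ring

lemma isLocalMax_line {g : EuclideanSpace ℝ (Fin n) → ℝ} {p : EuclideanSpace ℝ (Fin n)}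
    (h : IsLocalMax g p) (v : EuclideanSpace ℝ (Fin n)) :
    IsLocalMax (fun t : ℝ => g (p + t • v)) 0 := by
  have hc : Tendsto (fun t : ℝ => p + t • v) (𝓝 0) (𝓝 p) := by
    have := (line_hasDerivAt p v 0).continuousAt.tendsto
    simpa using this
  have := hc.eventually h
  filter_upwards [this] with t ht
  simpa using ht

lemma touch_max {u : EuclideanSpace ℝ (Fin n) → ℝ} (hu : ContDiff ℝ 2 u)
    {F F1 : ℝ → ℝ} {F2 : ℝ} {x0 p : EuclideanSpace ℝ (Fin n)}
    (hF : ∀ᶠ s in 𝓝 (‖p - x0‖ ^ 2), HasDerivAt F (F1 s) s)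
    (hF2 : HasDerivAt F1 F2 (‖p - x0‖ ^ 2))
    (hm : IsLocalMax (fun x => u x - F (‖x - x0‖ ^ 2)) p) :
    laplacian u p ≤ 2 * n * F1 (‖p - x0‖ ^ 2) + 4 * ‖p - x0‖ ^ 2 * F2 := by
  have key : ∀ i : Fin n, fderiv ℝ (fun y => fderiv ℝ u y (EuclideanSpace.single i 1)) p
      (EuclideanSpace.single i 1) ≤ 2 * F1 (‖p - x0‖ ^ 2) + 4 * ((p - x0) i) ^ 2 * F2 := by
    intro i
    set s0 := ‖p - x0‖ ^ 2 with hs0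
    set d := (p - x0) i with hd
    have hm' := isLocalMax_line hm (EuclideanSpace.single i 1)
    simp only [norm_line] at hm'
    rw [← hs0, ← hd] at hm'
    have hq : ∀ t : ℝ, HasDerivAt (fun t : ℝ => s0 + 2 * t * d + t ^ 2) (2 * d + 2 * t) t := by
      intro t
      have := ((((hasDerivAt_id t).const_mul 2).mul_const d).const_add s0).add
        ((hasDerivAt_id t).pow 2)
      exact this.congr_deriv (by simp)
    have hq0 : Tendsto (fun t : ℝ => s0 + 2 * t * d + t ^ 2) (𝓝 0) (𝓝 s0) := by
      have := (hq 0).continuousAt.tendsto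
      simpa using this
    have h1 : ∀ᶠ t in 𝓝 (0:ℝ), HasDerivAt
        (fun t : ℝ => u (p + t • EuclideanSpace.single i 1) - F (s0 + 2 * t * d + t ^ 2))
        (fderiv ℝ u (p + t • EuclideanSpace.single i 1) (EuclideanSpace.single i 1)
          - F1 (s0 + 2 * t * d + t ^ 2) * (2 * d + 2 * t)) t := by
      filter_upwards [hq0.eventually hF] with t ht
      exact (line1 hu p _ t).sub (HasDerivAt.comp t ht (hq t))
    have h2 : HasDerivAt (fun t : ℝ =>
        fderiv ℝ u (p + t • EuclideanSpace.single i 1) (EuclideanSpace.single i 1)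
          - F1 (s0 + 2 * t * d + t ^ 2) * (2 * d + 2 * t))
        (fderiv ℝ (fun y => fderiv ℝ u y (EuclideanSpace.single i 1)) p
          (EuclideanSpace.single i 1) - (F2 * (2 * d) * (2 * d) + F1 s0 * 2)) 0 := by
      refine (line2 hu p _).sub ?_
      have hF2' : HasDerivAt F1 F2 (s0 + 2 * (0:ℝ) * d + (0:ℝ) ^ 2) := by simpa using hF2
      have a := HasDerivAt.comp (0:ℝ) hF2' (hq 0)
      have b : HasDerivAt (fun t : ℝ => 2 * d + 2 * t) 2 0 := by
        simpa using ((hasDerivAt_id (0:ℝ)).const_mul 2).const_add (2 * d)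
      have := a.mul b
      exact this.congr_deriv (by simp)
    have := sec_max hm' h1 h2
    nlinarith [this]
  calc laplacian u p ≤ ∑ i : Fin n, (2 * F1 (‖p - x0‖ ^ 2) + 4 * ((p - x0) i) ^ 2 * F2) :=
        Finset.sum_le_sum fun i _ => key i
    _ = _ := by
        have e : ∑ i : Fin n, 4 * ((p - x0) i) ^ 2 * F2 = 4 * ‖p - x0‖ ^ 2 * F2 := by
          rw [← Finset.sum_mul, ← Finset.mul_sum, EuclideanSpace.real_norm_sq_eq (p - x0)]
        rw [Finset.sum_add_distrib, e, Finset.sum_const, Finset.card_univ, Fintype.card_fin,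
          nsmul_eq_mul]
        ring

lemma touch_min {u : EuclideanSpace ℝ (Fin n) → ℝ} (hu : ContDiff ℝ 2 u)
    {F F1 : ℝ → ℝ} {F2 : ℝ} {x0 p : EuclideanSpace ℝ (Fin n)}
    (hF : ∀ᶠ s in 𝓝 (‖p - x0‖ ^ 2), HasDerivAt F (F1 s) s)
    (hF2 : HasDerivAt F1 F2 (‖p - x0‖ ^ 2))
    (hm : IsLocalMin (fun x => u x - F (‖x - x0‖ ^ 2)) p) :
    2 * n * F1 (‖p - x0‖ ^ 2) + 4 * ‖p - x0‖ ^ 2 * F2 ≤ laplacian u p := by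
  have hm' : IsLocalMax (fun x => (fun y => -u y) x - (fun s => -F s) (‖x - x0‖ ^ 2)) p := by
    filter_upwards [hm] with x hx
    linarith
  have := touch_max hu.neg (F := fun s => -F s) (F1 := fun s => -F1 s) (F2 := -F2)
    (hF.mono fun s hs => hs.neg) hF2.neg hm'
  have h2 := laplacian_neg hu p
  rw [h2] at this
  linarith

/-- At a local maximum the Laplacian is nonpositive. -/
lemma laplacian_max {u : EuclideanSpace ℝ (Fin n) → ℝ} (hu : ContDiff ℝ 2 u)
    {p : EuclideanSpace ℝ (Fin n)} (hm : IsLocalMax u p) : laplacian u p ≤ 0 := by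
  have := touch_max hu (F := fun _ => 0) (F1 := fun _ => 0) (F2 := 0) (x0 := 0) (p := p)
    (Eventually.of_forall fun s => hasDerivAt_const _ _) (hasDerivAt_const _ _) (by simpa using hm)
  simpa using this

end basics

section tools
variable {n : ℕ}

/-- Keller–Osserman bound. -/
lemma keller_osserman {u : EuclideanSpace ℝ (Fin n) → ℝ} (hu : ContDiff ℝ 2 u)
    (hsol : ∀ x, laplacian u x = u x ^ 3 - u x) (x0 : EuclideanSpace ℝ (Fin n)) : u x0 ≤ 1 := by
  have step : ∀ R : ℝ, 0 < R → 1 < u x0 → (u x0 - 1) ^ 2 * R ^ 2 ≤ 2 * n + 8 := by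
    intro R hR h1
    have hcont : Continuous (fun x => (u x - 1) * (R ^ 2 - ‖x - x0‖ ^ 2)) :=
      (hu.continuous.sub continuous_const).mul (by fun_prop)
    obtain ⟨p, hp, hmax⟩ := (isCompact_closedBall x0 R).exists_isMaxOn
      ⟨x0, mem_closedBall_self hR.le⟩ hcont.continuousOn
    have hx0 : (u x0 - 1) * R ^ 2 ≤ (u p - 1) * (R ^ 2 - ‖p - x0‖ ^ 2) := by
      have := hmax (mem_closedBall_self hR.le)
      simpa using this
    set K := (u p - 1) * (R ^ 2 - ‖p - x0‖ ^ 2) with hK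
    have hKpos : 0 < K := lt_of_lt_of_le (by have : 0 < u x0 - 1 := by linarith
                                             positivity) hx0
    have hple : ‖p - x0‖ ≤ R := by simpa [dist_eq_norm] using hp
    have hs0 : 0 < R ^ 2 - ‖p - x0‖ ^ 2 := by
      have : 0 ≤ R ^ 2 - ‖p - x0‖ ^ 2 := by nlinarith [norm_nonneg (p - x0)]
      rcases this.lt_or_eq with h | h
      · exact h
      · rw [← h] at hK; simp at hK; linarith
    have hplt : ‖p - x0‖ < R := by nlinarith [norm_nonneg (p - x0)]
    set s := ‖p - x0‖ ^ 2 with hs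
    have hup : u p = 1 + K / (R ^ 2 - s) := by rw [hK]; field_simp; ring
    have hd : ∀ t : ℝ, t < R ^ 2 → HasDerivAt (fun t : ℝ => 1 + K / (R ^ 2 - t))
        (K / (R ^ 2 - t) ^ 2) t := by
      intro t ht
      have hne : R ^ 2 - t ≠ 0 := by linarith
      have := ((hasDerivAt_const t K).div ((hasDerivAt_id t).const_sub (R ^ 2)) hne).const_add 1
      exact this.congr_deriv (by simp)
    have hd2 : HasDerivAt (fun t : ℝ => K / (R ^ 2 - t) ^ 2) (2 * K / (R ^ 2 - s) ^ 3) s := by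
      have hne : (R ^ 2 - s) ^ 2 ≠ 0 := by positivity
      have := ((hasDerivAt_const s K).div (((hasDerivAt_id s).const_sub (R ^ 2)).pow 2) hne)
      refine this.congr_deriv ?_
      simp
      field_simp
    have hm : IsLocalMax (fun x => u x - (fun t : ℝ => 1 + K / (R ^ 2 - t)) (‖x - x0‖ ^ 2)) p := by
      have hball : ball x0 R ∈ 𝓝 p := isOpen_ball.mem_nhds (by simpa [dist_eq_norm] using hplt)
      filter_upwards [hball] with x hx
      have hx' : ‖x - x0‖ < R := by simpa [dist_eq_norm] using hx
      have hpos : 0 < R ^ 2 - ‖x - x0‖ ^ 2 := by nlinarith [norm_nonneg (x - x0)]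
      have hle : (u x - 1) * (R ^ 2 - ‖x - x0‖ ^ 2) ≤ K := hmax (ball_subset_closedBall hx)
      have : u x - 1 ≤ K / (R ^ 2 - ‖x - x0‖ ^ 2) := by rwa [le_div_iff₀ hpos]
      simp only [← hs]
      rw [hup]
      linarith
    have hT := touch_max hu (F1 := fun t => K / (R ^ 2 - t) ^ 2)
      ((Iio_mem_nhds (show s < R ^ 2 by linarith)) |> fun h =>
        Filter.mem_of_superset h fun t ht => hd t ht) hd2 hm
    rw [← hs, hsol, hup] at hT
    set g := R ^ 2 - s with hg
    set q := K / g with hq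
    have hqpos : 0 < q := by positivity
    have h3 : q ^ 3 ≤ 2 * n * (K / g ^ 2) + 4 * s * (2 * K / g ^ 3) := by
      have : q ^ 3 ≤ (1 + q) ^ 3 - (1 + q) := by nlinarith [sq_nonneg q]
      linarith
    have h4 : K ^ 3 ≤ 2 * n * K * g + 8 * s * K := by
      have e1 : q ^ 3 * g ^ 3 = K ^ 3 := by rw [hq]; field_simp
      have e2 : (2 * n * (K / g ^ 2) + 4 * s * (2 * K / g ^ 3)) * g ^ 3
          = 2 * n * K * g + 8 * s * K := by field_simp; ring
      rw [← e1, ← e2]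
      exact mul_le_mul_of_nonneg_right h3 (by positivity)
    have hsn : 0 ≤ s := by positivity
    have h5 : K ^ 2 ≤ (2 * n + 8) * R ^ 2 := by
      have : K * K ^ 2 ≤ K * (2 * n * g + 8 * s) := by nlinarith
      have h6 := le_of_mul_le_mul_left this hKpos
      have hn : (0:ℝ) ≤ n := Nat.cast_nonneg n
      nlinarith [mul_nonneg hn hsn]
    have h7 : ((u x0 - 1) * R ^ 2) ^ 2 ≤ (2 * n + 8) * R ^ 2 := by
      refine le_trans ?_ h5
      have : 0 ≤ u x0 - 1 := by linarith
      have h8 : (u x0 - 1) * R ^ 2 ≤ K := hx0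
      exact pow_le_pow_left₀ (by positivity) h8 2
    have hR2 : 0 < R ^ 2 := by positivity
    have : R ^ 2 * ((u x0 - 1) ^ 2 * R ^ 2) ≤ R ^ 2 * (2 * n + 8) := by nlinarith
    exact le_of_mul_le_mul_left this hR2
  by_contra hlt
  push Not at hlt
  have hd : 0 < u x0 - 1 := by linarith
  have := step (((2:ℝ) * n + 9) / (u x0 - 1)) (by positivity) hlt
  have e : (u x0 - 1) ^ 2 * ((2 * (n:ℝ) + 9) / (u x0 - 1)) ^ 2 = (2 * (n:ℝ) + 9) ^ 2 := by
    field_simp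
  rw [e] at this
  have hn : (0:ℝ) ≤ n := Nat.cast_nonneg n
  nlinarith

/-- Comparison principle on the whole space. -/
lemma comparison {v : EuclideanSpace ℝ (Fin n) → ℝ} (hv : ContDiff ℝ 2 v) {B c : ℝ} (hc : 0 < c)
    (hB : ∀ x, v x ≤ B) (hl : ∀ x, 0 < v x → c * v x ≤ laplacian v x) (x0) : v x0 ≤ 0 := by
  by_contra hpos
  push Not at hpos
  have hBpos : 0 < B := hpos.trans_le (hB x0)
  obtain ⟨ε, hε, hε2⟩ : ∃ ε : ℝ, 0 < ε ∧ 2 * n * ε < c * v x0 := by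
    refine ⟨c * v x0 / (2 * n + 1), by positivity, ?_⟩
    have : 0 < c * v x0 := by positivity
    rw [mul_div_assoc', div_lt_iff₀ (by positivity)]
    nlinarith
  set R := Real.sqrt (B / ε) with hR
  have hcont : Continuous (fun x => v x - ε * ‖x - x0‖ ^ 2) :=
    hv.continuous.sub (by fun_prop)
  obtain ⟨p, hp, hmax⟩ := (isCompact_closedBall x0 (R + 1)).exists_isMaxOn
    ⟨x0, mem_closedBall_self (by positivity)⟩ hcont.continuousOn
  have hx0 : v x0 ≤ v p - ε * ‖p - x0‖ ^ 2 := by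
    have := hmax (mem_closedBall_self (show 0 ≤ R + 1 by positivity))
    simpa using this
  have hvp : v x0 ≤ v p := by nlinarith [sq_nonneg ‖p - x0‖]
  have hplt : ‖p - x0‖ < R + 1 := by
    by_contra hge
    push Not at hge
    have hR2 : R ^ 2 = B / ε := Real.sq_sqrt (by positivity)
    have hRn : 0 ≤ R := Real.sqrt_nonneg _
    have : B < ε * ‖p - x0‖ ^ 2 := by
      have h1 : B = ε * R ^ 2 := by rw [hR2]; field_simp
      rw [h1]
      apply mul_lt_mul_of_pos_left _ hε
      nlinarith
    linarith [hB p]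
  have hm : IsLocalMax (fun x => v x - (fun s => ε * s) (‖x - x0‖ ^ 2)) p := by
    have hball : ball x0 (R + 1) ∈ 𝓝 p := isOpen_ball.mem_nhds (by simpa [dist_eq_norm] using hplt)
    filter_upwards [hball] with x hx
    exact hmax (ball_subset_closedBall hx)
  have hT := touch_max hv (F1 := fun _ => ε) (F2 := 0)
    (Eventually.of_forall fun s => by simpa using (hasDerivAt_id s).const_mul ε)
    (hasDerivAt_const _ _) hm
  have h2 := hl p (hpos.trans_le hvp)
  have h3 : c * v x0 ≤ c * v p := mul_le_mul_of_nonneg_left hvp hc.le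
  linarith

/-- A positive solution in a ball of radius n+2 is at least 1/√2 at the centre. -/
lemma lower_bound {w : EuclideanSpace ℝ (Fin n) → ℝ} (hw : ContDiff ℝ 2 w)
    (hsol : ∀ x, laplacian w x = w x ^ 3 - w x) (x0 : EuclideanSpace ℝ (Fin n))
    (hpos : ∀ x ∈ closedBall x0 ((n:ℝ) + 2), 0 < w x) : 1 / 2 ≤ w x0 ^ 2 := by
  set R : ℝ := (n:ℝ) + 2 with hR
  have hRpos : 0 < R := by positivity
  have hcont : ContinuousOn (fun x => (R ^ 2 - ‖x - x0‖ ^ 2) ^ 2 / w x) (closedBall x0 R) :=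
    ContinuousOn.div (by fun_prop) hw.continuous.continuousOn fun x hx => (hpos x hx).ne'
  obtain ⟨p, hp, hmax⟩ := (isCompact_closedBall x0 R).exists_isMaxOn
    ⟨x0, mem_closedBall_self hRpos.le⟩ hcont
  have hwp := hpos p hp
  have hw0 := hpos x0 (mem_closedBall_self hRpos.le)
  have hx0 : (R ^ 2) ^ 2 / w x0 ≤ (R ^ 2 - ‖p - x0‖ ^ 2) ^ 2 / w p := by
    have := hmax (mem_closedBall_self hRpos.le)
    simpa using this
  set K := (R ^ 2 - ‖p - x0‖ ^ 2) ^ 2 / w p with hK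
  have hKpos : 0 < K := lt_of_lt_of_le (by positivity) hx0
  have hple : ‖p - x0‖ ≤ R := by simpa [dist_eq_norm] using hp
  have hs0 : 0 < R ^ 2 - ‖p - x0‖ ^ 2 := by
    have : 0 ≤ R ^ 2 - ‖p - x0‖ ^ 2 := by nlinarith [norm_nonneg (p - x0)]
    rcases this.lt_or_eq with h | h
    · exact h
    · rw [← h] at hK; simp at hK; linarith
  have hplt : ‖p - x0‖ < R := by nlinarith [norm_nonneg (p - x0)]
  have hwpK : w p = (R ^ 2 - ‖p - x0‖ ^ 2) ^ 2 / K := by rw [hK]; field_simp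
  have hm : IsLocalMin (fun x => w x - (fun s : ℝ => (R ^ 2 - s) ^ 2 / K) (‖x - x0‖ ^ 2)) p := by
    have hball : ball x0 R ∈ 𝓝 p := isOpen_ball.mem_nhds (by simpa [dist_eq_norm] using hplt)
    filter_upwards [hball] with x hx
    have hwx := hpos x (ball_subset_closedBall hx)
    have hle : (R ^ 2 - ‖x - x0‖ ^ 2) ^ 2 / w x ≤ K := hmax (ball_subset_closedBall hx)
    have : (R ^ 2 - ‖x - x0‖ ^ 2) ^ 2 / K ≤ w x := by
      rw [div_le_iff₀ hwx] at hle
      rw [div_le_iff₀ hKpos]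
      linarith
    rw [← hwpK]
    linarith
  set s := ‖p - x0‖ ^ 2 with hs
  have hd : ∀ t : ℝ, HasDerivAt (fun t : ℝ => (R ^ 2 - t) ^ 2 / K) (-2 * (R ^ 2 - t) / K) t := by
    intro t
    have := (((hasDerivAt_id t).const_sub (R ^ 2)).pow 2).div_const K
    exact this.congr_deriv (by simp)
  have hd2 : HasDerivAt (fun t : ℝ => -2 * (R ^ 2 - t) / K) (2 / K) s := by
    have := (((hasDerivAt_id s).const_sub (R ^ 2)).const_mul (-2)).div_const K
    exact this.congr_deriv (by simp)
  have hT := touch_min hw (F1 := fun t => -2 * (R ^ 2 - t) / K)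
    (Eventually.of_forall hd) hd2 hm
  rw [← hs, hsol] at hT
  have hsn : 0 ≤ s := by positivity
  -- main algebra
  have hg : s = R ^ 2 - (R ^ 2 - s) := by ring
  set g := R ^ 2 - s with hgdef
  have hn : (0:ℝ) ≤ n := Nat.cast_nonneg n
  have e1 : 2 * n * (-2 * g / K) + 4 * s * (2 / K) ≥ -(1/2) * w p := by
    rw [hwpK]
    have : 2 * n * (-2 * g / K) + 4 * s * (2 / K) - (-(1/2) * (g ^ 2 / K))
        = (-4 * n * g + 8 * s + g ^ 2 / 2) / K := by field_simp; ring
    have h2 : 0 ≤ -4 * n * g + 8 * s + g ^ 2 / 2 := by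
      rw [hg]
      nlinarith [sq_nonneg (g - 4 * (n + 2))]
    have : 0 ≤ (-4 * n * g + 8 * s + g ^ 2 / 2) / K := by positivity
    linarith
  have e2 : 1 / 2 ≤ w p ^ 2 := by
    have : w p * (1/2) ≤ w p * w p ^ 2 := by nlinarith
    exact le_of_mul_le_mul_left this hwp
  -- compare w p and w x0
  have e3 : w p ≤ w x0 := by
    have h1 : (R ^ 2) ^ 2 / w x0 ≤ (R ^ 2) ^ 2 / w p := by
      refine hx0.trans ?_
      rw [hK]
      have : g ≤ R ^ 2 := by linarith
      gcongr
    have h4 : 0 < (R ^ 2) ^ 2 := by positivity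
    rw [div_le_div_iff_of_pos_left h4 hw0 hwp] at h1
    exact h1
  nlinarith

end tools

section estimates
variable {n : ℕ}

/-- Quantitative strong maximum principle. -/
lemma quant_harnack (n : ℕ) {C L : ℝ} (hC : 0 ≤ C) (hL : 0 < L) {η : ℝ} (hη : 0 < η) :
    ∃ δ > 0, ∀ w : EuclideanSpace ℝ (Fin n) → ℝ, ContDiff ℝ 2 w → (∀ x, 0 ≤ w x) →
      (∀ x y, |w x - w y| ≤ L * ‖x - y‖) → (∀ x, laplacian w x ≤ C * w x) →
      ∀ p q, ‖p - q‖ ≤ 1 → w p < δ → w q < η := by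
  set ρ : ℝ := min 1 (η / (2 * L)) with hρ
  have hρpos : 0 < ρ := by positivity
  have hρ1 : ρ ≤ 1 := min_le_left _ _
  have hρL : L * ρ ≤ η / 2 := by
    have : ρ ≤ η / (2 * L) := min_le_right _ _
    calc L * ρ ≤ L * (η / (2 * L)) := by gcongr
      _ = η / 2 := by field_simp
  set α : ℝ := (n + C + 1) / ρ ^ 2 with hα
  have hn : (0:ℝ) ≤ n := Nat.cast_nonneg n
  have hαρ : α * ρ ^ 2 = n + C + 1 := by rw [hα]; field_simp
  have hα1 : 1 ≤ α := by
    rw [hα, le_div_iff₀ (by positivity)]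
    nlinarith
  set F : ℝ → ℝ := fun s => η / 2 * (Real.exp (-α * s) - Real.exp (-α * 4)) with hF
  have hF1 : ∀ s, HasDerivAt F (η / 2 * (Real.exp (-α * s) * (-α))) s := by
    intro s
    have := ((((hasDerivAt_id s).const_mul (-α)).exp).sub_const (Real.exp (-α * 4))).const_mul (η/2)
    exact this.congr_deriv (by simp)
  have hF2 : ∀ s, HasDerivAt (fun s => η / 2 * (Real.exp (-α * s) * (-α)))
      (η / 2 * (Real.exp (-α * s) * (-α) * (-α))) s := by
    intro s
    have := ((((hasDerivAt_id s).const_mul (-α)).exp).mul_const (-α)).const_mul (η/2)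
    exact this.congr_deriv (by simp)
  have hFle : ∀ s, 0 ≤ s → F s ≤ η / 2 := by
    intro s hs
    have h1 : Real.exp (-α * s) ≤ 1 := Real.exp_le_one_iff.2 (by nlinarith)
    have h2 : 0 < Real.exp (-α * 4) := Real.exp_pos _
    simp only [hF]
    nlinarith
  have hFmono : ∀ s t, s ≤ t → F t ≤ F s := by
    intro s t hst
    have : Real.exp (-α * t) ≤ Real.exp (-α * s) := Real.exp_le_exp.2 (by nlinarith)
    simp only [hF]
    gcongr
  refine ⟨F 1, ?_, ?_⟩
  · have : Real.exp (-α * 4) < Real.exp (-α * 1) := Real.exp_lt_exp.2 (by nlinarith)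
    simp only [hF]
    have : 0 < Real.exp (-α * 1) - Real.exp (-α * 4) := by linarith
    positivity
  intro w hw hw0 hlip hlap p q hpq hwp
  by_contra hge
  push Not at hge
  have hcont : Continuous (fun x => w x - F (‖x - q‖ ^ 2)) := by
    have : Continuous F := continuous_iff_continuousAt.2 fun s => (hF1 s).continuousAt
    exact hw.continuous.sub (this.comp (by fun_prop))
  obtain ⟨z, hz, hmin⟩ := (isCompact_closedBall q (2:ℝ)).exists_isMinOn
    ⟨q, mem_closedBall_self (by norm_num)⟩ hcont.continuousOn
  have hzp : w z - F (‖z - q‖ ^ 2) ≤ w p - F (‖p - q‖ ^ 2) :=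
    hmin (by simp [dist_eq_norm]; linarith)
  have hneg : w z - F (‖z - q‖ ^ 2) < 0 := by
    have : F 1 ≤ F (‖p - q‖ ^ 2) := hFmono _ _ (by nlinarith [norm_nonneg (p - q)])
    linarith
  have hzle : ‖z - q‖ ≤ 2 := by simpa [dist_eq_norm] using hz
  have hzlt : ‖z - q‖ < 2 := by
    rcases hzle.lt_or_eq with h | h
    · exact h
    · have e : F (‖z - q‖ ^ 2) = 0 := by rw [h]; simp only [hF]; norm_num
      rw [e] at hneg
      linarith [hw0 z]
  have hzρ : ρ < ‖z - q‖ := by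
    by_contra hle
    push Not at hle
    have h1 := hlip q z
    have h2 : L * ‖q - z‖ ≤ L * ρ := by rw [norm_sub_rev]; gcongr
    have h3 := (abs_le.1 h1).2
    have h4 := hFle (‖z - q‖ ^ 2) (by positivity)
    linarith
  have hm : IsLocalMin (fun x => w x - F (‖x - q‖ ^ 2)) z := by
    have hball : ball q 2 ∈ 𝓝 z := isOpen_ball.mem_nhds (by simpa [dist_eq_norm] using hzlt)
    filter_upwards [hball] with x hx
    exact hmin (ball_subset_closedBall hx)
  have hT := touch_min hw (F1 := fun s => η / 2 * (Real.exp (-α * s) * (-α)))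
    (Eventually.of_forall hF1) (hF2 _) hm
  set s := ‖z - q‖ ^ 2 with hs
  have hsρ : ρ ^ 2 ≤ s := by rw [hs]; gcongr
  have hFs : F s ≤ η / 2 * Real.exp (-α * s) := by
    simp only [hF]
    have h2 : 0 < Real.exp (-α * 4) := Real.exp_pos _
    nlinarith
  have hE : 0 < η / 2 * Real.exp (-α * s) := by positivity
  set X := η / 2 * Real.exp (-α * s) with hX
  have e1 : 2 * n * (η / 2 * (Real.exp (-α * s) * (-α)))
      + 4 * s * (η / 2 * (Real.exp (-α * s) * (-α) * (-α))) = X * (4 * s * α ^ 2 - 2 * n * α) := by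
    rw [hX]; ring
  have hT' : X * (4 * s * α ^ 2 - 2 * n * α) ≤ laplacian w z := by rw [← e1]; exact hT
  have h5 : C * w z ≤ C * X := by
    apply mul_le_mul_of_nonneg_left _ hC
    linarith
  have h6 : C < 4 * s * α ^ 2 - 2 * n * α := by
    have a1 : ρ ^ 2 * α ^ 2 ≤ s * α ^ 2 := by gcongr
    have a2 : ρ ^ 2 * α ^ 2 = α * (n + C + 1) := by rw [← hαρ]; ring
    nlinarith [mul_nonneg hn (by linarith : 0 ≤ α), mul_nonneg hC (by linarith : 0 ≤ α - 1)]
  have h7 : X * C < X * (4 * s * α ^ 2 - 2 * n * α) := by gcongr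
  linarith [hlap z]

/-- reflection in the i-th coordinate -/
noncomputable def crefl (i : Fin n) (x : EuclideanSpace ℝ (Fin n)) : EuclideanSpace ℝ (Fin n) :=
  x - (2 * x i) • EuclideanSpace.single i (1:ℝ)

lemma crefl_coord (i : Fin n) (x : EuclideanSpace ℝ (Fin n)) : (crefl i x) i = - x i := by
  simp [crefl]; ring

lemma crefl_norm (i : Fin n) (x : EuclideanSpace ℝ (Fin n)) : ‖crefl i x‖ = ‖x‖ := by
  have h : ‖crefl i x‖ ^ 2 = ‖x‖ ^ 2 := by
    have := norm_line x 0 i (-(2 * x i))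
    simp only [sub_zero] at this
    have e : crefl i x = x + (-(2 * x i)) • EuclideanSpace.single i (1:ℝ) := by
      rw [crefl, neg_smul, sub_eq_add_neg]
    rw [e, this]; ring
  exact (pow_left_inj₀ (norm_nonneg _) (norm_nonneg _) two_ne_zero).1 h

lemma crefl_contDiff (i : Fin n) : ContDiff ℝ 2 (crefl i) := by
  unfold crefl
  fun_prop

lemma laplacian_crefl {w : EuclideanSpace ℝ (Fin n) → ℝ} (hw : ContDiff ℝ 2 w) (i : Fin n)
    (x : EuclideanSpace ℝ (Fin n)) :
    laplacian (fun y => w (crefl i y)) x = laplacian w (crefl i x) := by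
  set σ : Fin n → ℝ := fun j => if j = i then -1 else 1 with hσ
  have hσ2 : ∀ j, σ j * σ j = 1 := by intro j; simp only [hσ]; split_ifs <;> norm_num
  have hline : ∀ j (t : ℝ), crefl i (x + t • EuclideanSpace.single j (1:ℝ))
      = crefl i x + (σ j * t) • EuclideanSpace.single j (1:ℝ) := by
    intro j t
    ext k
    simp only [crefl, hσ, PiLp.add_apply, PiLp.sub_apply, PiLp.smul_apply, smul_eq_mul]
    by_cases hj : j = i
    · subst hj
      by_cases hk : k = j
      · subst hk; simp; ring
      · simp [hk]
    · by_cases hk : k = j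
      · subst hk; simp [hj]
      · have hj' : i ≠ j := fun h => hj h.symm
        simp [hk, hj']
  have hwr : ContDiff ℝ 2 (fun y => w (crefl i y)) := hw.comp (crefl_contDiff i)
  rw [laplacian_of_lines hwr x
    (fun j t => fderiv ℝ w (crefl i x + (σ j * t) • EuclideanSpace.single j 1)
      (EuclideanSpace.single j 1) * σ j)
    (fun j => fderiv ℝ (fun y => fderiv ℝ w y (EuclideanSpace.single j 1)) (crefl i x)
      (EuclideanSpace.single j 1)) ?_ ?_]
  · rfl
  · intro j t
    simp only [hline]
    have h1 : HasDerivAt (fun t : ℝ => σ j * t) (σ j) t := by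
      simpa using (hasDerivAt_id t).const_mul (σ j)
    exact HasDerivAt.comp t (line1 hw (crefl i x) (EuclideanSpace.single j 1) (σ j * t)) h1
  · intro j
    have h1 : HasDerivAt (fun t : ℝ => σ j * t) (σ j) 0 := by
      simpa using (hasDerivAt_id (0:ℝ)).const_mul (σ j)
    have h2 := line2 hw (crefl i x) (EuclideanSpace.single j 1)
    have h3 : HasDerivAt (fun t : ℝ => fderiv ℝ w (crefl i x + t • EuclideanSpace.single j 1)
      (EuclideanSpace.single j 1)) (fderiv ℝ (fun y => fderiv ℝ w y (EuclideanSpace.single j 1))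
        (crefl i x) (EuclideanSpace.single j 1)) (σ j * 0) := by simpa using h2
    have := (HasDerivAt.comp (0:ℝ) h3 h1).mul_const (σ j)
    refine this.congr_deriv ?_
    rw [mul_assoc, hσ2, mul_one]

/-- The function t - t² of the i-th coordinate. -/
lemma laplacian_quad (i : Fin n) (x : EuclideanSpace ℝ (Fin n)) :
    laplacian (fun y : EuclideanSpace ℝ (Fin n) => y i - (y i) ^ 2) x = -2 := by
  have hc : ContDiff ℝ 2 (fun y : EuclideanSpace ℝ (Fin n) => y i - (y i) ^ 2) := by fun_prop
  rw [laplacian_of_lines hc x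
    (fun j t => if j = i then 1 - 2 * (x i + t) else 0) (fun j => if j = i then -2 else 0) ?_ ?_]
  · simp
  · intro j t
    by_cases hj : j = i
    · subst hj
      simp only [PiLp.add_apply, PiLp.smul_apply, smul_eq_mul, if_true, PiLp.single_apply, mul_one]
      have h1 : HasDerivAt (fun t : ℝ => x j + t) 1 t := by simpa using (hasDerivAt_id t).const_add (x j)
      exact (h1.sub (h1.pow 2)).congr_deriv (by simp)
    · have hj' : i ≠ j := fun h => hj h.symm
      simp [hj, hj', hasDerivAt_const]
  · intro j
    by_cases hj : j = i
    · simp only [hj, if_true]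
      have h1 : HasDerivAt (fun t : ℝ => x i + t) 1 0 := by
        simpa using (hasDerivAt_id (0:ℝ)).const_add (x i)
      exact ((h1.const_mul 2).const_sub 1).congr_deriv (by norm_num)
    · simp [hj, hasDerivAt_const]

/-- Interior gradient estimate at the origin, one direction, one sign. -/
lemma grad_est0 {w : EuclideanSpace ℝ (Fin n) → ℝ} (hw : ContDiff ℝ 2 w) {A B : ℝ}
    (hA : ∀ y, ‖y‖ ≤ 1 → |w y| ≤ A) (hB : ∀ y, ‖y‖ ≤ 1 → |laplacian w y| ≤ B) (i : Fin n) :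
    fderiv ℝ w 0 (EuclideanSpace.single i 1) ≤ n * A + B := by
  have hA0 : 0 ≤ A := (abs_nonneg _).trans (hA 0 (by simp))
  have hB0 : 0 ≤ B := (abs_nonneg _).trans (hB 0 (by simp))
  have hn : (0:ℝ) ≤ n := Nat.cast_nonneg n
  -- main inequality
  have main : ∀ B' > B, ∀ t : ℝ, 0 ≤ t → t ≤ 1 →
      w (t • EuclideanSpace.single i 1) - w (-(t • EuclideanSpace.single i 1))
        ≤ 2 * A * t ^ 2 + (2 * A * n + B') * (t - t ^ 2) := by
    intro B' hB' t ht0 ht1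
    have hBp : 0 ≤ B' := by linarith
    set c := 2 * A * n + B' with hc
    have hc0 : 0 ≤ c := by positivity
    set g : EuclideanSpace ℝ (Fin n) → ℝ := fun y => (w y - w (crefl i y)) - c * (y i - (y i) ^ 2)
      with hg
    have hwr : ContDiff ℝ 2 (fun y => w (crefl i y)) := hw.comp (crefl_contDiff i)
    have hquad : ContDiff ℝ 2 (fun y : EuclideanSpace ℝ (Fin n) => y i - (y i) ^ 2) := by fun_prop
    have hgc : ContDiff ℝ 2 g := (hw.sub hwr).sub (contDiff_const.mul hquad)
    have hgl : ∀ x, laplacian g x = laplacian w x - laplacian w (crefl i x) + 2 * c := by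
      intro x
      have h1 := laplacian_sub (hw.sub hwr) ((contDiff_const (c := c)).mul hquad) x
      have h2 := laplacian_sub hw hwr x
      have h3 := laplacian_const_mul hquad c x
      rw [laplacian_quad] at h3
      rw [laplacian_crefl hw] at h2
      rw [hg]
      rw [h1, h2, h3]
      ring
    set S : Set (EuclideanSpace ℝ (Fin n)) := closedBall 0 1 ∩ {y | 0 ≤ y i} with hS
    have hScomp : IsCompact S := (isCompact_closedBall 0 1).inter_right
      (isClosed_le continuous_const (by fun_prop))
    have hcont : Continuous (fun x => g x - 2 * A * ‖x - 0‖ ^ 2) :=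
      hgc.continuous.sub (by fun_prop)
    obtain ⟨z, hz, hmax⟩ := hScomp.exists_isMaxOn ⟨0, by simp [hS]⟩ hcont.continuousOn
    have hz1 : ‖z‖ ≤ 1 := by simpa using hz.1
    have hzi : 0 ≤ z i := hz.2
    have hzi1 : z i ≤ 1 := by
      have := PiLp.norm_apply_le z i
      rw [Real.norm_eq_abs, abs_of_nonneg hzi] at this
      linarith
    have hval : g z - 2 * A * ‖z - 0‖ ^ 2 ≤ 0 := by
      by_contra hpos
      push Not at hpos
      rw [sub_zero] at hpos
      have hq : 0 ≤ c * (z i - z i ^ 2) := mul_nonneg hc0 (by nlinarith)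
      have hz1' : ‖z‖ < 1 := by
        rcases hz1.lt_or_eq with h | h
        · exact h
        · have a1 := (abs_le.1 (hA z hz1)).2
          have a2 := (abs_le.1 (hA (crefl i z) (by rw [crefl_norm]; exact hz1))).1
          rw [h] at hpos
          simp only [hg] at hpos
          linarith
      have hzi' : 0 < z i := by
        rcases hzi.lt_or_eq with h | h
        · exact h
        · have e : crefl i z = z := by rw [crefl, ← h]; simp
          simp only [hg] at hpos
          rw [e, ← h] at hpos
          have : 0 ≤ 2 * A * ‖z‖ ^ 2 := by positivity
          linarith
      have hm : IsLocalMax (fun x => g x - (fun s => 2 * A * s) (‖x - 0‖ ^ 2)) z := by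
        have hb : ball (0 : EuclideanSpace ℝ (Fin n)) 1 ∈ 𝓝 z :=
          isOpen_ball.mem_nhds (by simpa using hz1')
        have hb2 : {y : EuclideanSpace ℝ (Fin n) | 0 < y i} ∈ 𝓝 z :=
          (isOpen_lt continuous_const (by fun_prop)).mem_nhds hzi'
        filter_upwards [hb, hb2] with x hx hx2
        exact hmax ⟨ball_subset_closedBall hx, le_of_lt hx2⟩
      have hT := touch_max hgc (F1 := fun _ => 2 * A) (F2 := 0)
        (Eventually.of_forall fun s => by simpa using (hasDerivAt_id s).const_mul (2 * A))
        (hasDerivAt_const _ _) hm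
      rw [hgl] at hT
      have b1 := (abs_le.1 (hB z hz1)).1
      have b2 := (abs_le.1 (hB (crefl i z) (by rw [crefl_norm]; exact hz1))).2
      rw [hc] at hT
      linarith
    have hte : ‖t • EuclideanSpace.single i (1:ℝ)‖ = t := by
      rw [norm_smul]; simp [abs_of_nonneg ht0]
    have hti : (t • EuclideanSpace.single i (1:ℝ)) i = t := by simp
    have hmem : t • EuclideanSpace.single i (1:ℝ) ∈ S := by
      refine ⟨by simpa [mem_closedBall, hte] using ht1, ?_⟩
      change 0 ≤ (t • EuclideanSpace.single i (1:ℝ)) i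
      rw [hti]; exact ht0
    have h := (hmax hmem).trans hval
    change g (t • EuclideanSpace.single i (1:ℝ))
      - 2 * A * ‖t • EuclideanSpace.single i (1:ℝ) - 0‖ ^ 2 ≤ 0 at h
    rw [sub_zero, hte] at h
    have hr : crefl i (t • EuclideanSpace.single i (1:ℝ)) = -(t • EuclideanSpace.single i (1:ℝ)) := by
      rw [crefl, hti, ← sub_smul, ← neg_smul]; congr 1; ring
    simp only [hg] at h
    rw [hr, hti] at h
    linarith
  -- differentiate at 0
  set D := fderiv ℝ w 0 (EuclideanSpace.single i 1) with hD
  apply le_of_forall_pos_le_add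
  intro ε hε
  have hm := main (B + ε) (by linarith)
  set c := 2 * A * n + (B + ε) with hc
  have hd1 : HasDerivAt (fun t : ℝ => w (t • EuclideanSpace.single i 1)) D 0 := by
    have := line1 hw 0 (EuclideanSpace.single i 1) 0
    simpa using this
  have hd2 : HasDerivAt (fun t : ℝ => w (-(t • EuclideanSpace.single i 1))) (-D) 0 := by
    have h0 : HasDerivAt (fun t : ℝ => w (t • EuclideanSpace.single i 1)) D (-0) := by
      simpa using hd1
    have := HasDerivAt.comp (0:ℝ) h0 (hasDerivAt_neg (0:ℝ))
    simpa [Function.comp_def] using this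
  have hd3 : HasDerivAt (fun t : ℝ => 2 * A * t ^ 2 + c * (t - t ^ 2)
      - (w (t • EuclideanSpace.single i 1) - w (-(t • EuclideanSpace.single i 1))))
      (c - 2 * D) 0 := by
    have e1 : HasDerivAt (fun t : ℝ => t ^ 2) 0 0 := by
      simpa using (hasDerivAt_pow 2 (0:ℝ))
    have := ((e1.const_mul (2 * A)).add (((hasDerivAt_id (0:ℝ)).sub e1).const_mul c)).sub
      (hd1.sub hd2)
    exact this.congr_deriv (by ring)
  have hfin : 0 ≤ c - 2 * D := by
    have hs := hd3.hasDerivWithinAt (s := Set.Ioi 0)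
    rw [hasDerivWithinAt_iff_tendsto_slope' (by simp)] at hs
    refine ge_of_tendsto hs ?_
    have : Set.Ioo (0:ℝ) 1 ∈ 𝓝[>] (0:ℝ) := Ioo_mem_nhdsGT one_pos
    filter_upwards [this] with t ht
    have := hm t ht.1.le ht.2.le
    rw [slope_def_field]
    apply div_nonneg _ (by linarith [ht.1])
    simp
    linarith
  rw [hc] at hfin
  linarith

/-- Interior gradient estimate. -/
lemma grad_est {w : EuclideanSpace ℝ (Fin n) → ℝ} (hw : ContDiff ℝ 2 w) {A B : ℝ}
    (x : EuclideanSpace ℝ (Fin n))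
    (hA : ∀ y, ‖y - x‖ ≤ 1 → |w y| ≤ A) (hB : ∀ y, ‖y - x‖ ≤ 1 → |laplacian w y| ≤ B) :
    ‖fderiv ℝ w x‖ ≤ n * (n * A + B) := by
  have hA0 : 0 ≤ A := (abs_nonneg _).trans (hA x (by simp))
  have hB0 : 0 ≤ B := (abs_nonneg _).trans (hB x (by simp))
  have hwt := contDiff_translate hw x
  have hfd : fderiv ℝ (fun y => w (y + x)) 0 = fderiv ℝ w x := by
    rw [fderiv_comp_add_right]; simp
  have key : ∀ i : Fin n, |fderiv ℝ w x (EuclideanSpace.single i 1)| ≤ n * A + B := by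
    intro i
    rw [abs_le]
    constructor
    · have := grad_est0 (A := A) (B := B) hwt.neg
        (fun y hy => by rw [abs_neg]; exact hA _ (by simpa using hy))
        (fun y hy => by
          have e := laplacian_neg hwt y
          rw [laplacian_translate hw] at e
          rw [e, abs_neg]; exact hB _ (by simpa using hy)) i
      rw [fderiv_fun_neg, hfd] at this
      simp only [neg_apply] at this
      linarith
    · have := grad_est0 (A := A) (B := B) hwt
        (fun y hy => hA _ (by simpa using hy))
        (fun y hy => by
          rw [laplacian_translate hw]; exact hB _ (by simpa using hy)) i
      rwa [hfd] at this
  apply ContinuousLinearMap.opNorm_le_bound _ (by positivity)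
  intro v
  have hv : v = ∑ i, v i • EuclideanSpace.single i (1:ℝ) := by
    ext k
    simp [Finset.sum_apply, Pi.single_apply]
  calc ‖fderiv ℝ w x v‖ = ‖∑ i, v i • fderiv ℝ w x (EuclideanSpace.single i 1)‖ := by
        conv_lhs => rw [hv]
        rw [map_sum]; simp only [map_smul]
    _ ≤ ∑ i, ‖v i • fderiv ℝ w x (EuclideanSpace.single i 1)‖ := norm_sum_le _ _
    _ ≤ ∑ i : Fin n, ‖v‖ * (n * A + B) := by
        apply Finset.sum_le_sum
        intro i _
        rw [norm_smul]
        exact mul_le_mul (PiLp.norm_apply_le v i) (key i) (norm_nonneg _) (norm_nonneg _)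
    _ = n * (n * A + B) * ‖v‖ := by simp; ring

end estimates

section heteroclinic

lemma H_hasDerivAt (t : ℝ) : HasDerivAt H ((1 - H t ^ 2) / Real.sqrt 2) t := by
  have h1 : HasDerivAt Real.tanh (1 - Real.tanh (t / Real.sqrt 2) ^ 2) (t / Real.sqrt 2) := by
    have hc := (Real.cosh_pos (t / Real.sqrt 2)).ne'
    have := (Real.hasDerivAt_sinh (t / Real.sqrt 2)).div (Real.hasDerivAt_cosh (t / Real.sqrt 2)) hc
    have e : Real.tanh = Real.sinh / Real.cosh := by
      funext x; simp [Real.tanh_eq_sinh_div_cosh]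
    rw [e]
    refine this.congr_deriv ?_
    simp only [Pi.div_apply]
    field_simp
  have h2 : HasDerivAt (fun t : ℝ => t / Real.sqrt 2) (1 / Real.sqrt 2) t :=
    (hasDerivAt_id t).div_const _
  exact (HasDerivAt.comp t h1 h2).congr_deriv (by simp only [H]; ring)

lemma H_hasDerivAt2 (t : ℝ) :
    HasDerivAt (fun t => (1 - H t ^ 2) / Real.sqrt 2) (H t ^ 3 - H t) t := by
  have := (((H_hasDerivAt t).pow 2).const_sub 1).div_const (Real.sqrt 2)
  refine this.congr_deriv ?_
  have h2 : Real.sqrt 2 ^ 2 = 2 := Real.sq_sqrt (by norm_num)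
  field_simp
  rw [h2]
  norm_num
  ring

lemma H_lt (t : ℝ) : H t < 1 := Real.tanh_lt_one _
lemma H_gt (t : ℝ) : -1 < H t := Real.neg_one_lt_tanh _
lemma H_neg (t : ℝ) : H (-t) = - H t := by simp [H, neg_div, Real.tanh_neg]

lemma H_contDiff : ContDiff ℝ 2 H := by
  have e : H = fun t => Real.sinh (t / Real.sqrt 2) / Real.cosh (t / Real.sqrt 2) := by
    funext x; simp [H, Real.tanh_eq_sinh_div_cosh]
  rw [e]
  have h : ContDiff ℝ 2 (fun t : ℝ => t / Real.sqrt 2) := by fun_prop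
  exact (Real.contDiff_sinh.comp h).div (Real.contDiff_cosh.comp h)
    fun x => (Real.cosh_pos _).ne'

lemma H_mono : Monotone H := by
  apply monotone_of_deriv_nonneg (fun t => (H_hasDerivAt t).differentiableAt)
  intro t
  rw [(H_hasDerivAt t).deriv]
  apply div_nonneg _ (Real.sqrt_nonneg _)
  nlinarith [H_lt t, H_gt t]

lemma H_lip (s t : ℝ) : |H s - H t| ≤ |s - t| := by
  have := Convex.norm_image_sub_le_of_norm_hasDerivWithin_le (f := H) (C := 1) (s := Set.univ)
    (x := t) (y := s)
    (fun x _ => (H_hasDerivAt x).hasDerivWithinAt) (fun x _ => by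
      have h1 : 1 ≤ Real.sqrt 2 := Real.one_le_sqrt.2 (by norm_num)
      rw [Real.norm_eq_abs, abs_of_nonneg]
      · rw [div_le_one (by positivity)]
        nlinarith [sq_nonneg (H x)]
      · apply div_nonneg _ (Real.sqrt_nonneg _)
        nlinarith [H_lt x, H_gt x]) convex_univ trivial trivial
  simpa using this

lemma H_exists (c : ℝ) (h1 : -1 < c) (h2 : c < 1) : ∃ T, H T = c := by
  refine ⟨Real.sqrt 2 * Real.artanh c, ?_⟩
  have : Real.sqrt 2 * Real.artanh c / Real.sqrt 2 = Real.artanh c := by field_simp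
  rw [H, this, Real.tanh_artanh ⟨h1, h2⟩]

variable {n : ℕ}

lemma Hk_contDiff (k : Fin n) (a : ℝ) :
    ContDiff ℝ 2 (fun x : EuclideanSpace ℝ (Fin n) => H (x k + a)) := by
  have : ContDiff ℝ 2 (fun x : EuclideanSpace ℝ (Fin n) => x k + a) := by fun_prop
  exact H_contDiff.comp this

lemma Hk_laplacian (k : Fin n) (a : ℝ) (x : EuclideanSpace ℝ (Fin n)) :
    laplacian (fun x : EuclideanSpace ℝ (Fin n) => H (x k + a)) x
      = H (x k + a) ^ 3 - H (x k + a) := by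
  rw [laplacian_of_lines (Hk_contDiff k a) x
    (fun j t => if j = k then (1 - H (x k + t + a) ^ 2) / Real.sqrt 2 else 0)
    (fun j => if j = k then H (x k + a) ^ 3 - H (x k + a) else 0) ?_ ?_]
  · simp
  · intro j t
    by_cases hj : j = k
    · subst hj
      simp only [PiLp.add_apply, PiLp.smul_apply, smul_eq_mul, if_true, PiLp.single_apply, mul_one]
      have h1 : HasDerivAt (fun t : ℝ => x j + t + a) 1 t := by
        simpa using ((hasDerivAt_id t).const_add (x j)).add_const a
      exact (HasDerivAt.comp t (H_hasDerivAt _) h1).congr_deriv (by simp)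
    · have hj' : k ≠ j := fun h => hj h.symm
      simp [hj, hj', hasDerivAt_const]
  · intro j
    by_cases hj : j = k
    · simp only [hj, if_true]
      have h1 : HasDerivAt (fun t : ℝ => x k + t + a) 1 0 := by
        simpa using ((hasDerivAt_id (0:ℝ)).const_add (x k)).add_const a
      have h2 : HasDerivAt (fun t => (1 - H t ^ 2) / Real.sqrt 2) (H (x k + a) ^ 3 - H (x k + a))
        (x k + 0 + a) := by simpa using H_hasDerivAt2 (x k + a)
      have h3 := HasDerivAt.comp (0:ℝ) h2 h1
      rw [mul_one] at h3
      exact h3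
    · simp [hj, hasDerivAt_const]

/-- The sliding comparison. -/
lemma slide {u : EuclideanSpace ℝ (Fin n) → ℝ} (hu : ContDiff ℝ 2 u)
    (hsol : ∀ x, laplacian u x = u x ^ 3 - u x) (hu1 : ∀ x, u x ≤ 1) (k : Fin n) (a : ℝ)
    (h : ∀ x, H (x k + a) < u x → 7 / 10 ≤ H (x k + a) ∨ u x ≤ -(7 / 10)) (x) :
    u x ≤ H (x k + a) := by
  have := comparison (v := fun x => u x - H (x k + a)) (hu.sub (Hk_contDiff k a)) (B := 2)
    (c := 2 / 5) (by norm_num) (fun x => by linarith [hu1 x, H_gt (x k + a)]) (fun x hx => ?_) x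
  · linarith
  · rw [laplacian_sub hu (Hk_contDiff k a), Hk_laplacian, hsol]
    set b := H (x k + a)
    have hx' : b < u x := by linarith
    have hP : 7 / 5 ≤ u x ^ 2 + u x * b + b ^ 2 := by
      rcases h x hx' with h1 | h1
      · nlinarith
      · nlinarith
    have e : u x ^ 3 - u x - (b ^ 3 - b) = (u x - b) * (u x ^ 2 + u x * b + b ^ 2 - 1) := by ring
    rw [e]
    nlinarith

lemma start {u : EuclideanSpace ℝ (Fin n) → ℝ} (hu : ContDiff ℝ 2 u)
    (hsol : ∀ x, laplacian u x = u x ^ 3 - u x) (hu1 : ∀ x, u x ≤ 1) (k : Fin n)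
    (hneg : ∀ x : EuclideanSpace ℝ (Fin n), x k < 0 → u x < 0) :
    ∃ a, ∀ x : EuclideanSpace ℝ (Fin n), u x ≤ H (x k + a) := by
  obtain ⟨T, hT⟩ := H_exists (7 / 10) (by norm_num) (by norm_num)
  refine ⟨T + (n + 3), fun x => slide hu hsol hu1 k _ (fun x _ => ?_) x⟩
  by_cases hx : -((n:ℝ) + 3) ≤ x k
  · left
    rw [← hT]
    exact H_mono (by linarith)
  · right
    push Not at hx
    have hw := lower_bound (w := fun y => -u y) hu.neg (fun y => by
      rw [laplacian_neg hu, hsol]; ring) x (fun y hy => by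
        have h1 : ‖y - x‖ ≤ n + 2 := by simpa [dist_eq_norm] using hy
        have h2 := (abs_le.1 ((PiLp.norm_apply_le (y - x) k).trans h1)).2
        simp only [PiLp.sub_apply] at h2
        have := hneg y (by linarith)
        linarith)
    have hn : (0:ℝ) ≤ n := Nat.cast_nonneg n
    have := hneg x (by linarith)
    nlinarith

end heteroclinic

section final

theorem tlu_of_norm {α G : Type*} [TopologicalSpace α] [SeminormedAddCommGroup G]
    {F : ℕ → α → G} {f : α → G} (D : ℕ → α → G) (hD : ∀ j z, F j z = f z - D j z)
    (h : ∀ ε > 0, ∀ x : α, ∃ t ∈ 𝓝 x, ∀ᶠ j in atTop, ∀ z ∈ t, ‖D j z‖ < ε) :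
    TendstoLocallyUniformly F f atTop := by
  rw [Metric.tendstoLocallyUniformly_iff]
  simpa only [dist_eq_norm, hD, sub_sub_cancel] using h

variable {n : ℕ}

lemma harnack_iter {w : EuclideanSpace ℝ (Fin n) → ℝ} {C L : ℝ} (hC : 0 ≤ C) (hL : 0 < L)
    (hw : ContDiff ℝ 2 w) (hw0 : ∀ x, 0 ≤ w x)
    (hlip : ∀ x y, |w x - w y| ≤ L * ‖x - y‖) (hlap : ∀ x, laplacian w x ≤ C * w x) (m : ℕ) :
    ∀ η > 0, ∃ δ > 0, ∀ p q, ‖p - q‖ ≤ m → w p < δ → w q < η := by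
  induction m with
  | zero =>
    intro η hη
    refine ⟨η, hη, fun p q hpq hp => ?_⟩
    have : p = q := by
      rw [← sub_eq_zero, ← norm_le_zero_iff]; simpa using hpq
    rwa [← this]
  | succ m ih =>
    intro η hη
    obtain ⟨δ1, hδ1, h1⟩ := quant_harnack n hC hL hη
    obtain ⟨δ, hδ, h2⟩ := ih δ1 hδ1
    refine ⟨δ, hδ, fun p q hpq hp => ?_⟩
    push_cast at hpq
    set s : ℝ := (m:ℝ) / (m + 1) with hs
    set q' := p + s • (q - p) with hq'
    have hm : (0:ℝ) < m + 1 := by positivity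
    have hs0 : 0 ≤ s := by positivity
    have hs1 : 1 - s = 1 / (m + 1) := by rw [hs]; field_simp; ring
    have e1 : ‖p - q'‖ ≤ m := by
      have : p - q' = s • (p - q) := by rw [hq', ← neg_sub p q, smul_neg]; abel
      rw [this, norm_smul, Real.norm_eq_abs, abs_of_nonneg hs0]
      calc s * ‖p - q‖ ≤ s * (m + 1) := by gcongr
        _ = m := by rw [hs]; field_simp
    have e2 : ‖q' - q‖ ≤ 1 := by
      have : q' - q = (1 - s) • (p - q) := by
        rw [hq', sub_smul, one_smul, ← neg_sub p q, smul_neg]; abel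
      rw [this, norm_smul, hs1, Real.norm_eq_abs, abs_of_nonneg (by positivity)]
      calc 1 / ((m:ℝ) + 1) * ‖p - q‖ ≤ 1 / ((m:ℝ) + 1) * (m + 1) := by gcongr
        _ = 1 := by field_simp
    exact h1 w hw hw0 hlip hlap q' q e2 (h2 p q' e1 hp)

lemma abs_lap_le {b v : ℝ} (hb : |b| ≤ 1) (hv : |v| ≤ 1) (hw : 0 ≤ b - v) :
    |b ^ 3 - b - (v ^ 3 - v)| ≤ 2 * (b - v) := by
  obtain ⟨h1, h2⟩ := abs_le.1 hb
  obtain ⟨h3, h4⟩ := abs_le.1 hv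
  have e : b ^ 3 - b - (v ^ 3 - v) = (b - v) * (b ^ 2 + b * v + v ^ 2 - 1) := by ring
  have p1 : b ^ 2 + b * v + v ^ 2 - 1 ≤ 2 := by nlinarith
  have p2 : -2 ≤ b ^ 2 + b * v + v ^ 2 - 1 := by nlinarith [sq_nonneg (b + v)]
  rw [e, abs_mul, abs_of_nonneg hw, mul_comm]
  exact mul_le_mul_of_nonneg_right (abs_le.2 ⟨p2, p1⟩) hw

lemma diff_lap_le {b0 v0 b1 v1 d1 d2 d3 η : ℝ} (hb0 : |b0| ≤ 1) (hv0 : |v0| ≤ 1)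
    (hb1 : |b1| ≤ 1) (hv1 : |v1| ≤ 1) (hη : |b0 - v0| ≤ η)
    (h1 : |b1 - b0| ≤ d1) (h2 : |v1 - v0| ≤ d2) (h3 : |(b1 - v1) - (b0 - v0)| ≤ d3) :
    |(b1 ^ 3 - b1 - (v1 ^ 3 - v1)) - (b0 ^ 3 - b0 - (v0 ^ 3 - v0))|
      ≤ 2 * d3 + η * (3 * (d1 + d2)) := by
  have e : (b1 ^ 3 - b1 - (v1 ^ 3 - v1)) - (b0 ^ 3 - b0 - (v0 ^ 3 - v0))
      = (b1 ^ 2 + b1 * v1 + v1 ^ 2 - 1) * ((b1 - v1) - (b0 - v0))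
        + (b0 - v0) * ((b1 - b0) * (b1 + b0 + v1) + (v1 - v0) * (b0 + v1 + v0)) := by ring
  have hP : |b1 ^ 2 + b1 * v1 + v1 ^ 2 - 1| ≤ 2 := by
    obtain ⟨h1, h2⟩ := abs_le.1 hb1
    obtain ⟨h3, h4⟩ := abs_le.1 hv1
    exact abs_le.2 ⟨by nlinarith [sq_nonneg (b1 + v1)], by nlinarith⟩
  have q1 : |b1 + b0 + v1| ≤ 3 := (abs_add_three _ _ _).trans (by linarith)
  have q2 : |b0 + v1 + v0| ≤ 3 := (abs_add_three _ _ _).trans (by linarith)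
  have d10 := (abs_nonneg _).trans h1
  have d20 := (abs_nonneg _).trans h2
  have d30 := (abs_nonneg _).trans h3
  have η0 := (abs_nonneg _).trans hη
  rw [e]
  refine (abs_add_le _ _).trans (add_le_add ?_ ?_)
  · rw [abs_mul]; exact mul_le_mul hP h3 (abs_nonneg _) (by norm_num)
  · rw [abs_mul]
    refine mul_le_mul hη ?_ (abs_nonneg _) η0
    refine (abs_add_le _ _).trans ?_
    rw [abs_mul, abs_mul]
    have a1 := mul_le_mul h1 q1 (abs_nonneg _) d10
    have a2 := mul_le_mul h2 q2 (abs_nonneg _) d20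
    linarith

theorem core (u : EuclideanSpace ℝ (Fin n) → ℝ) (k : Fin n)
    (hu : IsACSolution u) (hnc : ¬ ∃ c : ℝ, ∀ x, u x = c)
    (hneg : ∀ x : EuclideanSpace ℝ (Fin n), x k < 0 → u x < 0) :
    ∃ a : ℝ,
      (∀ x : EuclideanSpace ℝ (Fin n), u x ≤ H (x k + a)) ∧
      ((∀ x : EuclideanSpace ℝ (Fin n), u x = H (x k + a)) ∨
       ((∀ x : EuclideanSpace ℝ (Fin n), u x < H (x k + a)) ∧
        ∃ y : ℕ → EuclideanSpace ℝ (Fin n),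
          (∀ j, y j k = 0) ∧
          Filter.Tendsto (fun j => ‖y j‖) Filter.atTop Filter.atTop ∧
          TendstoLocallyUniformly (fun j x => u (x + y j))
            (fun x : EuclideanSpace ℝ (Fin n) => H (x k + a)) Filter.atTop ∧
          TendstoLocallyUniformly (fun j x => fderiv ℝ (fun z => u (z + y j)) x)
            (fderiv ℝ (fun x : EuclideanSpace ℝ (Fin n) => H (x k + a)))
            Filter.atTop ∧
          TendstoLocallyUniformly
            (fun j x => fderiv ℝ (fderiv ℝ (fun z => u (z + y j))) x)
            (fderiv ℝ (fderiv ℝ (fun x : EuclideanSpace ℝ (Fin n) => H (x k + a))))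
            Filter.atTop)) := by
  obtain ⟨huc, hsol'⟩ := hu
  have hsol : ∀ x, laplacian u x = u x ^ 3 - u x := fun x => by linarith [hsol' x]
  have hu1 : ∀ x, u x ≤ 1 := keller_osserman huc hsol
  have hum1 : ∀ x, -1 ≤ u x := fun x => by
    have := keller_osserman (u := fun y => -u y) huc.neg
      (fun y => by rw [laplacian_neg huc, hsol]; ring) x
    linarith
  have huabs : ∀ x, |u x| ≤ 1 := fun x => abs_le.2 ⟨hum1 x, hu1 x⟩
  have hHabs : ∀ t, |H t| ≤ 1 := fun t => abs_le.2 ⟨(H_gt t).le, (H_lt t).le⟩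
  set S : Set ℝ := {a | ∀ x : EuclideanSpace ℝ (Fin n), u x ≤ H (x k + a)} with hS
  have hSne : S.Nonempty := start huc hsol hu1 k hneg
  have hSbdd : BddBelow S := by
    obtain ⟨x1, hx1⟩ : ∃ x1, -1 < u x1 := by
      by_contra hcon
      push Not at hcon
      exact hnc ⟨-1, fun x => le_antisymm (hcon x) (hum1 x)⟩
    have hd : (u x1 - 1) / 2 < 1 := by linarith [hu1 x1]
    obtain ⟨T, hT⟩ := H_exists ((u x1 - 1) / 2) (by linarith) hd
    refine ⟨T - x1 k, fun a ha => ?_⟩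
    by_contra hlt
    push Not at hlt
    have h1 := ha x1
    have h2 : H (x1 k + a) ≤ H T := H_mono (by linarith)
    rw [hT] at h2
    have h3 := (H_gt (x1 k + a))
    by_cases h : u x1 < 1
    · linarith
    · linarith [H_lt (x1 k + a)]
  set a := sInf S with ha
  have haS : ∀ x : EuclideanSpace ℝ (Fin n), u x ≤ H (x k + a) := by
    intro x
    apply le_of_forall_pos_le_add
    intro ε hε
    obtain ⟨b, hb, hbl⟩ := Real.lt_sInf_add_pos hSne hε
    have h1 := hb x
    have h2 : H (x k + b) ≤ H (x k + a + ε) := H_mono (by rw [ha]; linarith)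
    have h3 := (abs_le.1 (H_lip (x k + a + ε) (x k + a))).2
    have h4 : |x k + a + ε - (x k + a)| = ε := by
      rw [show x k + a + ε - (x k + a) = ε by ring, abs_of_pos hε]
    linarith
  refine ⟨a, haS, ?_⟩
  -- the difference
  set w : EuclideanSpace ℝ (Fin n) → ℝ := fun x => H (x k + a) - u x with hw
  have hwc : ContDiff ℝ 2 w := (Hk_contDiff k a).sub huc
  have hw0 : ∀ x, 0 ≤ w x := fun x => by simp only [hw]; linarith [haS x]
  have hwl : ∀ x, laplacian w x = H (x k + a) ^ 3 - H (x k + a) - (u x ^ 3 - u x) := by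
    intro x
    rw [hw, laplacian_sub (Hk_contDiff k a) huc, Hk_laplacian, hsol]
  have hwl2 : ∀ x, |laplacian w x| ≤ 2 * w x := by
    intro x
    rw [hwl]
    exact abs_lap_le (hHabs _) (huabs x) (hw0 x)
  have hw2 : ∀ x, w x ≤ 2 := fun x => by
    simp only [hw]; linarith [H_lt (x k + a), hum1 x]
  have hnn : (0:ℝ) ≤ n := Nat.cast_nonneg n
  -- first derivative estimate
  set c1 : ℝ := n * (n + 2) with hc1
  have hc1n : 0 ≤ c1 := by positivity
  have hgrad : ∀ (q) (η : ℝ), (∀ y, ‖y - q‖ ≤ 1 → w y ≤ η) → ‖fderiv ℝ w q‖ ≤ c1 * η := by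
    intro q η h
    have := grad_est hwc (A := η) (B := 2 * η) q
      (fun y hy => by rw [abs_of_nonneg (hw0 y)]; exact h y hy)
      (fun y hy => (hwl2 y).trans (by linarith [h y hy]))
    refine this.trans (le_of_eq ?_)
    rw [hc1]; ring
  have hwd : Differentiable ℝ w := hwc.differentiable (by norm_num)
  set L : ℝ := c1 * 2 + 1 with hL
  have hLpos : 0 < L := by positivity
  have hlip : ∀ x y, |w x - w y| ≤ L * ‖x - y‖ := by
    intro x y
    have := Convex.norm_image_sub_le_of_norm_fderiv_le (f := w) (C := L) (s := Set.univ)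
      (x := y) (y := x) (𝕜 := ℝ) (fun z _ => hwd z)
      (fun z _ => (hgrad z 2 (fun y _ => hw2 y)).trans (by rw [hL]; linarith))
      convex_univ trivial trivial
    simpa using this
  have hharn := harnack_iter (C := 2) (by norm_num) hLpos hwc hw0 hlip
    (fun x => (le_abs_self _).trans (hwl2 x))
  -- second derivative estimate
  obtain ⟨c2, hc2n, hhess⟩ : ∃ c2 : ℝ, 0 ≤ c2 ∧ ∀ (q) (η : ℝ), (∀ y, ‖y - q‖ ≤ 3 → w y ≤ η) →
      ‖fderiv ℝ (fderiv ℝ w) q‖ ≤ c2 * η := by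
    refine ⟨n * (n * c1 + (2 * c1 + 3 * (2 + L))), by positivity, ?_⟩
    intro q η h
    have hη : 0 ≤ η := (hw0 q).trans (h q (by simp))
    apply norm_fderiv_le_of_lip' ℝ (by positivity)
    have hb : ball q 1 ∈ 𝓝 q := ball_mem_nhds _ one_pos
    filter_upwards [hb] with q1 hq1
    set v := q1 - q with hv
    have hv1 : ‖v‖ ≤ 1 := by rw [hv, ← dist_eq_norm]; exact (mem_ball.1 hq1).le
    have hq1e : q1 = q + v := by rw [hv]; abel
    have hDc : ContDiff ℝ 2 (fun y => w (y + v) - w y) := (contDiff_translate hwc v).sub hwc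
    have hfd : fderiv ℝ (fun y => w (y + v) - w y) q = fderiv ℝ w q1 - fderiv ℝ w q := by
      rw [fderiv_fun_sub ((contDiff_translate hwc v).differentiable (by norm_num) q) (hwd q),
        fderiv_comp_add_right, hq1e]
    rw [← hfd]
    have hD : ∀ y, ‖y - q‖ ≤ 1 → |w (y + v) - w y| ≤ c1 * η * ‖v‖ := by
      intro y hy
      have := Convex.norm_image_sub_le_of_norm_fderiv_le (f := w) (C := c1 * η)
        (s := closedBall q 2) (x := y) (y := y + v) (𝕜 := ℝ) (fun z _ => hwd z)
        (fun z hz => hgrad z η (fun y' hy' => h y' (by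
          have h1 : ‖z - q‖ ≤ 2 := by simpa [dist_eq_norm] using hz
          calc ‖y' - q‖ = ‖(y' - z) + (z - q)‖ := by congr 1; abel
            _ ≤ ‖y' - z‖ + ‖z - q‖ := norm_add_le _ _
            _ ≤ 3 := by linarith)))
        (convex_closedBall q 2) (by rw [mem_closedBall, dist_eq_norm]; linarith) (by
          rw [mem_closedBall, dist_eq_norm]
          calc ‖y + v - q‖ = ‖(y - q) + v‖ := by congr 1; abel
            _ ≤ ‖y - q‖ + ‖v‖ := norm_add_le _ _
            _ ≤ 2 := by linarith)
      simpa using this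
    have hest := grad_est hDc (A := c1 * η * ‖v‖)
      (B := 2 * (c1 * η * ‖v‖) + η * (3 * (‖v‖ + (1 + L) * ‖v‖))) q hD (fun y hy => by
        rw [laplacian_sub (contDiff_translate hwc v) hwc, laplacian_translate hwc, hwl, hwl]
        have hHd : |H ((y + v) k + a) - H (y k + a)| ≤ ‖v‖ := by
          refine (H_lip _ _).trans ?_
          have : (y + v) k + a - (y k + a) = v k := by simp
          rw [this]
          exact PiLp.norm_apply_le v k
        have hwd' : |w (y + v) - w y| ≤ L * ‖v‖ := by simpa using hlip (y + v) y
        refine diff_lap_le (hHabs _) (huabs _) (hHabs _) (huabs _) ?_ hHd ?_ (hD y hy)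
        · have : |w y| ≤ η := by rw [abs_of_nonneg (hw0 y)]; exact h y (by linarith)
          exact this
        · have e : u (y + v) - u y = (H ((y + v) k + a) - H (y k + a)) - (w (y + v) - w y) := by
            simp only [hw]; ring
          rw [e]
          refine (abs_sub _ _).trans ?_
          linarith)
    refine hest.trans (le_of_eq ?_)
    ring
  by_cases hex : ∃ p, w p = 0
  · -- equality case
    left
    obtain ⟨p, hp⟩ := hex
    intro x
    have hx : w x = 0 := by
      apply le_antisymm _ (hw0 x)
      apply le_of_forall_pos_lt_add
      intro η hη
      obtain ⟨m, hm⟩ := exists_nat_ge ‖p - x‖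
      obtain ⟨δ, hδ, h⟩ := hharn m η hη
      have := h p x hm (by rw [hp]; exact hδ)
      linarith
    simp only [hw] at hx
    linarith
  right
  push Not at hex
  have hwpos : ∀ x, 0 < w x := fun x => lt_of_le_of_ne (hw0 x) (hex x).symm
  refine ⟨fun x => by have := hwpos x; simp only [hw] at this; linarith, ?_⟩
  -- the strip
  obtain ⟨M, hM0, hM⟩ : ∃ M : ℝ, 0 ≤ M ∧ ∀ δ > 0, ∃ x : EuclideanSpace ℝ (Fin n),
      |x k| ≤ M ∧ w x < δ := by
    obtain ⟨T, hT⟩ := H_exists (7 / 10) (by norm_num) (by norm_num)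
    refine ⟨|T| + |a| + 1, by positivity, ?_⟩
    intro δ hδ
    by_contra hcon
    push Not at hcon
    set ε := min δ 1 with hε
    have hεpos : 0 < ε := by positivity
    have hmem : a - ε ∈ S := by
      intro x
      refine slide huc hsol hu1 k (a - ε) (fun x hx => ?_) x
      have hε1 : ε ≤ 1 := min_le_right _ _
      have hεδ : ε ≤ δ := min_le_left _ _
      by_cases hxk : |x k| ≤ |T| + |a| + 1
      · exfalso
        have h1 := hcon x hxk
        simp only [hw] at h1
        have h3 := (abs_le.1 (H_lip (x k + a) (x k + (a - ε)))).2
        have h4 : |x k + a - (x k + (a - ε))| = ε := by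
          rw [show x k + a - (x k + (a - ε)) = ε by ring, abs_of_pos hεpos]
        linarith
      · push Not at hxk
        have t1 := abs_le.1 (le_refl |T|)
        have t2 := abs_le.1 (le_refl |a|)
        rcases lt_abs.1 hxk with h | h
        · left
          rw [← hT]
          exact H_mono (by linarith)
        · right
          refine (haS x).trans ?_
          rw [← hT, ← H_neg]
          exact H_mono (by linarith)
    have := csInf_le hSbdd hmem
    linarith
  choose xs hxs1 hxs2 using fun j : ℕ => hM (1 / ((j:ℝ) + 1)) (by positivity)
  set y : ℕ → EuclideanSpace ℝ (Fin n) := fun j => xs j - (xs j k) • EuclideanSpace.single k 1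
    with hy
  have hyk : ∀ j, y j k = 0 := fun j => by simp [hy]
  have hyx : ∀ j, ‖xs j - y j‖ ≤ M := by
    intro j
    have : xs j - y j = (xs j k) • EuclideanSpace.single k (1:ℝ) := by simp [hy]
    rw [this, norm_smul]
    simpa using hxs1 j
  have hsmall : ∀ δ > 0, ∀ᶠ j : ℕ in atTop, w (xs j) < δ := by
    intro δ hδ
    have h := (tendsto_one_div_add_atTop_nhds_zero_nat (𝕜 := ℝ)).eventually (gt_mem_nhds hδ)
    filter_upwards [h] with j hj using (hxs2 j).trans hj
  -- local smallness
  have hloc : ∀ (x) (η : ℝ), 0 < η → ∀ᶠ j : ℕ in atTop, ∀ z ∈ ball x 1,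
      ∀ z', ‖z' - (z + y j)‖ ≤ 3 → w z' ≤ η := by
    intro x η hη
    obtain ⟨m, hm⟩ := exists_nat_ge (M + (‖x‖ + 1) + 3)
    obtain ⟨δ, hδ, h⟩ := hharn m η hη
    filter_upwards [hsmall δ hδ] with j hj z hz z' hz'
    refine (h (xs j) z' ?_ hj).le
    have hz1 : ‖z‖ ≤ ‖x‖ + 1 := by
      have : ‖z - x‖ < 1 := by simpa [dist_eq_norm] using hz
      calc ‖z‖ = ‖x + (z - x)‖ := by congr 1; abel
        _ ≤ ‖x‖ + ‖z - x‖ := norm_add_le _ _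
        _ ≤ _ := by linarith
    calc ‖xs j - z'‖ = ‖(xs j - y j) - z - (z' - (z + y j))‖ := by congr 1; abel
      _ ≤ ‖xs j - y j‖ + ‖z‖ + ‖z' - (z + y j)‖ :=
        (norm_sub_le _ _).trans (add_le_add (norm_sub_le _ _) le_rfl)
      _ ≤ m := by linarith [hyx j]
  have hfun : ∀ j, (fun z => u (z + y j)) = fun z => H (z k + a) - w (z + y j) := by
    intro j; funext z
    simp [hw, hyk]
  have hHd : Differentiable ℝ (fun x : EuclideanSpace ℝ (Fin n) => H (x k + a)) :=
    (Hk_contDiff k a).differentiable (by norm_num)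
  have hfd1 : ∀ j, fderiv ℝ (fun z => u (z + y j)) = fun z =>
      fderiv ℝ (fun x : EuclideanSpace ℝ (Fin n) => H (x k + a)) z - fderiv ℝ w (z + y j) := by
    intro j; funext z
    rw [hfun, fderiv_fun_sub (hHd z)
      ((contDiff_translate hwc (y j)).differentiable (by norm_num) z), fderiv_comp_add_right]
  have hfd2 : ∀ j z, fderiv ℝ (fderiv ℝ (fun z => u (z + y j))) z =
      fderiv ℝ (fderiv ℝ (fun x : EuclideanSpace ℝ (Fin n) => H (x k + a))) z
        - fderiv ℝ (fderiv ℝ w) (z + y j) := by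
    intro j z
    have g1 : Differentiable ℝ (fderiv ℝ (fun x : EuclideanSpace ℝ (Fin n) => H (x k + a))) :=
      ((Hk_contDiff k a).fderiv_right (m := 1) (by norm_num)).differentiable (by norm_num)
    have g2 : Differentiable ℝ (fderiv ℝ w) :=
      (hwc.fderiv_right (m := 1) (by norm_num)).differentiable (by norm_num)
    have g3 : DifferentiableAt ℝ (fun z => fderiv ℝ w (z + y j)) z :=
      (g2.comp (differentiable_id.add_const (y j))) z
    rw [hfd1, fderiv_fun_sub (g1 z) g3, fderiv_comp_add_right]
  have hpick : ∀ c : ℝ, 0 ≤ c → ∀ ε > 0, ∃ η > 0, c * η < ε := by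
    intro c hc ε hε
    refine ⟨ε / (c + 1), by positivity, ?_⟩
    rw [mul_div_assoc', div_lt_iff₀ (by positivity)]
    nlinarith
  refine ⟨y, hyk, ?_, ?_, ?_, ?_⟩
  · -- norms tend to infinity
    rw [Filter.tendsto_atTop]
    intro R
    obtain ⟨z, -, hz⟩ := (isCompact_closedBall (0 : EuclideanSpace ℝ (Fin n))
      (|R| + M)).exists_isMinOn ⟨0, mem_closedBall_self (by positivity)⟩ hwc.continuous.continuousOn
    filter_upwards [hsmall (w z) (hwpos z)] with j hj
    by_contra hlt
    push Not at hlt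
    have : xs j ∈ closedBall (0 : EuclideanSpace ℝ (Fin n)) (|R| + M) := by
      rw [mem_closedBall, dist_zero_right]
      calc ‖xs j‖ = ‖y j + (xs j - y j)‖ := by congr 1; abel
        _ ≤ ‖y j‖ + ‖xs j - y j‖ := norm_add_le _ _
        _ ≤ _ := by linarith [hyx j, le_abs_self R]
    have h2 : w z ≤ w (xs j) := hz this
    linarith
  · rw [Metric.tendstoLocallyUniformly_iff]
    intro ε hε x
    refine ⟨ball x 1, ball_mem_nhds _ one_pos, ?_⟩
    filter_upwards [hloc x (ε / 2) (by positivity)] with j hj z hz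
    have h1 := hj z hz (z + y j) (by simp)
    have h2 : u (z + y j) = H (z k + a) - w (z + y j) := congrFun (hfun j) z
    rw [h2, dist_eq_norm, sub_sub_cancel, Real.norm_eq_abs, abs_of_nonneg (hw0 _)]
    linarith
  · rw [Metric.tendstoLocallyUniformly_iff]
    intro ε hε x
    obtain ⟨η, hη, hc⟩ := hpick c1 hc1n ε hε
    refine ⟨ball x 1, ball_mem_nhds _ one_pos, ?_⟩
    filter_upwards [hloc x η hη] with j hj z hz
    rw [hfd1, dist_eq_norm, sub_sub_cancel]
    exact (hgrad _ η fun z' hz' => hj z hz z' (by linarith)).trans_lt hc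
  · refine tlu_of_norm (α := EuclideanSpace ℝ (Fin n))
      (G := EuclideanSpace ℝ (Fin n) →L[ℝ] EuclideanSpace ℝ (Fin n) →L[ℝ] ℝ)
      (fun j z => fderiv ℝ (fderiv ℝ w) (z + y j)) hfd2 ?_
    intro ε hε x
    obtain ⟨η, hη, hc⟩ := hpick c2 hc2n ε hε
    refine ⟨ball x 1, ball_mem_nhds _ one_pos, ?_⟩
    filter_upwards [hloc x η hη] with j hj z hz
    exact (hhess _ η fun z' hz' => hj z hz z' hz').trans_lt hc

end final


end helpers

theorem half_space_below {n : ℕ} (hn1 : 1 ≤ n)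
    (u : EuclideanSpace ℝ (Fin n) → ℝ)
    (hu : IsACSolution u) (hnc : ¬ ∃ c : ℝ, ∀ x, u x = c)
    (hneg : ∀ x : EuclideanSpace ℝ (Fin n), x ⟨n - 1, by omega⟩ < 0 → u x < 0) :
    ∃ a : ℝ,
      (∀ x : EuclideanSpace ℝ (Fin n), u x ≤ H (x ⟨n - 1, by omega⟩ + a)) ∧
      ((∀ x : EuclideanSpace ℝ (Fin n), u x = H (x ⟨n - 1, by omega⟩ + a)) ∨
       ((∀ x : EuclideanSpace ℝ (Fin n), u x < H (x ⟨n - 1, by omega⟩ + a)) ∧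
        ∃ y : ℕ → EuclideanSpace ℝ (Fin n),
          (∀ k, y k ⟨n - 1, by omega⟩ = 0) ∧
          Filter.Tendsto (fun k => ‖y k‖) Filter.atTop Filter.atTop ∧
          TendstoLocallyUniformly (fun k x => u (x + y k))
            (fun x : EuclideanSpace ℝ (Fin n) => H (x ⟨n - 1, by omega⟩ + a)) Filter.atTop ∧
          TendstoLocallyUniformly (fun k x => fderiv ℝ (fun z => u (z + y k)) x)
            (fderiv ℝ (fun x : EuclideanSpace ℝ (Fin n) => H (x ⟨n - 1, by omega⟩ + a)))
            Filter.atTop ∧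
          TendstoLocallyUniformly
            (fun k x => fderiv ℝ (fderiv ℝ (fun z => u (z + y k))) x)
            (fderiv ℝ (fderiv ℝ (fun x : EuclideanSpace ℝ (Fin n) => H (x ⟨n - 1, by omega⟩ + a))))
            Filter.atTop)) := by
  exact core u _ hu hnc hneg
end

section
/- Let n ≥ 1 and let u be a non-constant solution of the Allen–Cahn equation −Δu = u − u³ on ℝⁿ. Assume u(x) > 0 for every x with xₙ < 0. Then there exists a real number a such that u(x) ≥ H(−xₙ + a) for all x ∈ ℝⁿ, and either u(x) = H(−xₙ + a) for all x ∈ ℝⁿ, or u(x) > H(−xₙ + a) for all x ∈ ℝⁿ and there exists a sequence of points (y_k) in ℝ^{n−1}×{0} with |y_k| → +∞ such that the translated functions x ↦ u(x + y_k) converge, locally uniformly on ℝⁿ together with their first and second derivatives, to the function x ↦ H(−xₙ + a). -/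
open scoped RealInnerProductSpace

namespace ACaux

open Filter Topology Set

/-- Necessary second order condition at a local maximum, one variable. -/
lemma second_test {g g' : ℝ → ℝ} {d : ℝ} (hmax : IsLocalMax g 0)
    (h1 : ∀ᶠ t in 𝓝 (0:ℝ), HasDerivAt g (g' t) t) (h2 : HasDerivAt g' d 0) : d ≤ 0 := by
  by_contra hd
  push Not at hd
  have hder : deriv g =ᶠ[𝓝 0] g' := h1.mono fun t ht => ht.deriv
  have hdd : deriv (deriv g) 0 = d := by
    rw [hder.deriv_eq]; exact h2.deriv
  have hmin : IsLocalMin g 0 :=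
    isLocalMin_of_deriv_deriv_pos (by rw [hdd]; exact hd) hmax.deriv_eq_zero
      h1.self_of_nhds.continuousAt
  have hc : g =ᶠ[𝓝 0] fun _ => g 0 := by
    filter_upwards [hmax, hmin] with t h1 h2
    exact le_antisymm h1 h2
  have hz : deriv g =ᶠ[𝓝 0] fun _ => 0 := by
    have := hc.deriv
    simpa using this
  have : deriv (deriv g) 0 = 0 := by
    rw [hz.deriv_eq]; simp
  linarith

lemma hd_congr {f g : ℝ → ℝ} {a b x : ℝ} (h : HasDerivAt f a x) (hfg : ∀ t, g t = f t)
    (hab : b = a) : HasDerivAt g b x := by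
  have : g = f := funext hfg
  rw [this, hab]; exact h

variable {n : ℕ}

local notation "E" => EuclideanSpace ℝ (Fin n)

/-- coordinate vector -/
noncomputable abbrev ev (i : Fin n) : E := EuclideanSpace.single i (1:ℝ)

/-- `g` has pure second derivatives at `x`, with sum `S`. -/
def HasLap (g : E → ℝ) (x : E) (S : ℝ) : Prop :=
  ∃ d : Fin n → ℝ, S = ∑ i, d i ∧ ∀ i, ∃ g' : ℝ → ℝ,
    (∀ᶠ t in 𝓝 (0:ℝ), HasDerivAt (fun s => g (x + s • ev i)) (g' t) t) ∧
      HasDerivAt g' (d i) 0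

lemma line_hasDerivAt (x : E) (i : Fin n) (t : ℝ) :
    HasDerivAt (fun s : ℝ => x + s • ev i) (ev i) t := by
  simpa using ((hasDerivAt_id t).smul_const (ev i)).const_add x

lemma hasLap_of_contDiff {u : E → ℝ} (hu : ContDiff ℝ 2 u) (x : E) :
    HasLap u x (laplacian u x) := by
  refine ⟨_, rfl, fun i => ⟨fun t => fderiv ℝ u (x + t • ev i) (ev i), ?_, ?_⟩⟩
  · refine Eventually.of_forall fun t => ?_
    have h := (hu.differentiable (by norm_num) (x + t • ev i)).hasFDerivAt
    exact h.comp_hasDerivAt t (line_hasDerivAt x i t)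
  · have h1 : ContDiff ℝ 1 (fderiv ℝ u) := hu.fderiv_right (by norm_num)
    have h2 : Differentiable ℝ (fun y => fderiv ℝ u y (ev i)) :=
      (h1.differentiable (by norm_num)).clm_apply (differentiable_const _)
    have h := (h2 (x + (0:ℝ) • ev i)).hasFDerivAt
    have := h.comp_hasDerivAt (0:ℝ) (line_hasDerivAt x i 0)
    exact hd_congr this (fun s => rfl) (by simp)

lemma HasLap.sub {g h : E → ℝ} {x : E} {S T : ℝ} (hg : HasLap g x S) (hh : HasLap h x T) :
    HasLap (fun y => g y - h y) x (S - T) := by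
  obtain ⟨d, rfl, hd⟩ := hg
  obtain ⟨d', rfl, hd'⟩ := hh
  refine ⟨fun i => d i - d' i, by simp, fun i => ?_⟩
  obtain ⟨a, ha, ha'⟩ := hd i
  obtain ⟨b, hb, hb'⟩ := hd' i
  refine ⟨fun t => a t - b t, ?_, ha'.sub hb'⟩
  filter_upwards [ha, hb] with t h1 h2 using h1.sub h2

lemma HasLap.const_mul {g : E → ℝ} {x : E} {S : ℝ} (c : ℝ) (hg : HasLap g x S) :
    HasLap (fun y => c * g y) x (c * S) := by
  obtain ⟨d, rfl, hd⟩ := hg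
  refine ⟨fun i => c * d i, by rw [Finset.mul_sum], fun i => ?_⟩
  obtain ⟨a, ha, ha'⟩ := hd i
  refine ⟨fun t => c * a t, ?_, ha'.const_mul c⟩
  filter_upwards [ha] with t h1 using h1.const_mul c

lemma HasLap.add {g h : E → ℝ} {x : E} {S T : ℝ} (hg : HasLap g x S) (hh : HasLap h x T) :
    HasLap (fun y => g y + h y) x (S + T) := by
  have := hg.sub (hh.const_mul (-1))
  convert this using 1
  · ext y; ring
  · ring

lemma HasLap.unique {g : E → ℝ} {x : E} {S T : ℝ} (hg : HasLap g x S) (hh : HasLap g x T) :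
    S = T := by
  obtain ⟨d, rfl, hd⟩ := hg
  obtain ⟨d', rfl, hd'⟩ := hh
  refine Finset.sum_congr rfl fun i _ => ?_
  obtain ⟨a, ha, ha'⟩ := hd i
  obtain ⟨b, hb, hb'⟩ := hd' i
  have : a =ᶠ[𝓝 0] b := by
    filter_upwards [ha, hb] with t h1 h2 using h1.unique h2
  exact ha'.unique (hb'.congr_of_eventuallyEq this)

lemma HasLap.nonpos {g : E → ℝ} {x : E} {S : ℝ} (hg : HasLap g x S) (hm : IsLocalMax g x) :
    S ≤ 0 := by
  obtain ⟨d, rfl, hd⟩ := hg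
  refine Finset.sum_nonpos fun i _ => ?_
  obtain ⟨a, ha, ha'⟩ := hd i
  refine second_test ?_ ha ha'
  have hc : Tendsto (fun s : ℝ => x + s • ev i) (𝓝 0) (𝓝 x) := by
    have := (line_hasDerivAt x i 0).continuousAt.tendsto
    simpa using this
  have := hc.eventually hm
  filter_upwards [this] with t ht
  simpa using ht

lemma norm_line (x z : E) (i : Fin n) (t : ℝ) :
    ‖x + t • ev i - z‖ ^ 2 = ‖x - z‖ ^ 2 + 2 * t * (x - z) i + t ^ 2 := by
  have : x + t • ev i - z = (x - z) + t • ev i := by abel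
  rw [this, norm_add_sq_real, inner_smul_right, norm_smul]
  have h : inner ℝ (x - z) (ev i) = (x - z) i := by
    simp [ev, EuclideanSpace.inner_single_right]
  rw [h]
  simp [ev]
  ring

lemma hasLap_radial {F F' : ℝ → ℝ} {F'' : ℝ} (x z : E)
    (h1 : ∀ᶠ s in 𝓝 (‖x - z‖ ^ 2), HasDerivAt F (F' s) s)
    (h2 : HasDerivAt F' F'' (‖x - z‖ ^ 2)) :
    HasLap (fun y => F (‖y - z‖ ^ 2)) x
      (4 * F'' * ‖x - z‖ ^ 2 + 2 * n * F' (‖x - z‖ ^ 2)) := by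
  have hq : ∀ (i : Fin n) (t : ℝ), HasDerivAt
      (fun t : ℝ => ‖x - z‖ ^ 2 + 2 * t * (x - z) i + t ^ 2) (2 * (x - z) i + 2 * t) t := by
    intro i t
    have := (((hasDerivAt_id t).const_mul 2).mul_const ((x - z) i)).const_add (‖x - z‖ ^ 2)
    have := this.add (hasDerivAt_pow 2 t)
    exact hd_congr this (fun s => rfl) (by simp)
  refine ⟨fun i => 4 * F'' * (x - z) i ^ 2 + 2 * F' (‖x - z‖ ^ 2), ?_, fun i => ?_⟩
  · rw [Finset.sum_add_distrib, ← Finset.mul_sum, EuclideanSpace.norm_sq_eq]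
    simp
    ring
  · refine ⟨fun t => F' (‖x - z‖ ^ 2 + 2 * t * (x - z) i + t ^ 2) * (2 * (x - z) i + 2 * t), ?_, ?_⟩
    · have hc : Tendsto (fun t : ℝ => ‖x - z‖ ^ 2 + 2 * t * (x - z) i + t ^ 2) (𝓝 0)
          (𝓝 (‖x - z‖ ^ 2)) := by
        have := (hq i 0).continuousAt.tendsto
        simpa using this
      filter_upwards [hc.eventually h1] with t ht
      have := ht.comp t (hq i t)
      exact hd_congr this (fun s => by simp only [Function.comp]; rw [norm_line]) rfl
    · have h2' : HasDerivAt F' F'' (‖x - z‖ ^ 2 + 2 * 0 * (x - z) i + 0 ^ 2) := by simpa using h2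
      have h3 := h2'.comp (0:ℝ) (hq i 0)
      have h4 : HasDerivAt (fun t : ℝ => 2 * (x - z) i + 2 * t) 2 0 := by
        simpa using ((hasDerivAt_id (0:ℝ)).const_mul 2).const_add (2 * (x - z) i)
      have := h3.mul h4
      exact hd_congr this (fun s => rfl) (by simp; ring)

lemma ev_apply (i j : Fin n) : (ev i : E) j = if j = i then 1 else 0 := by
  simp [ev]

lemma hasLap_coord {F F' : ℝ → ℝ} {F'' : ℝ} (p : Fin n) (x : E)
    (h1 : ∀ s, HasDerivAt F (F' s) s) (h2 : HasDerivAt F' F'' (x p)) :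
    HasLap (fun y : E => F (y p)) x F'' := by
  classical
  refine ⟨fun i => if i = p then F'' else 0, by simp, fun i => ?_⟩
  by_cases hi : i = p
  · subst hi
    have hl : ∀ t : ℝ, HasDerivAt (fun t : ℝ => x i + t) 1 t := fun t => by
      simpa using (hasDerivAt_id t).const_add (x i)
    refine ⟨fun t => F' (x i + t), Eventually.of_forall fun t => ?_, ?_⟩
    · have := (h1 (x i + t)).comp t (hl t)
      exact hd_congr this (fun s => by simp) (by simp)
    · have h2' : HasDerivAt F' F'' (x i + 0) := by simpa using h2
      have := h2'.comp (0:ℝ) (hl 0)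
      exact hd_congr this (fun s => rfl) (by simp)
  · have hi' : p ≠ i := fun h => hi h.symm
    refine ⟨fun t => 0, Eventually.of_forall fun t => ?_, ?_⟩
    · simpa [hi', hi] using hasDerivAt_const t (F (x p))
    · simpa [hi] using hasDerivAt_const (0:ℝ) (0:ℝ)

/-- reflection in the `i`-th coordinate about `c`. -/
noncomputable def rfl' (i : Fin n) (c : ℝ) (x : E) : E := x - (2 * (x i - c)) • ev i

lemma rfl'_line_same (i : Fin n) (c : ℝ) (x : E) (t : ℝ) :
    rfl' i c (x + t • ev i) = rfl' i c x + (-t) • ev i := by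
  simp only [rfl', PiLp.add_apply, PiLp.smul_apply, ev_apply, if_true, smul_eq_mul, mul_one]
  module

lemma rfl'_line_ne {i j : Fin n} (h : i ≠ j) (c : ℝ) (x : E) (t : ℝ) :
    rfl' i c (x + t • ev j) = rfl' i c x + t • ev j := by
  simp only [rfl', PiLp.add_apply, PiLp.smul_apply, ev_apply, if_neg h, smul_eq_mul, mul_zero,
    add_zero]
  module

lemma HasLap.refl {g : E → ℝ} (i : Fin n) (c : ℝ) {x : E} {S : ℝ}
    (hg : HasLap g (rfl' i c x) S) : HasLap (fun y => g (rfl' i c y)) x S := by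
  obtain ⟨d, rfl, hd⟩ := hg
  refine ⟨d, rfl, fun j => ?_⟩
  obtain ⟨a, ha, ha'⟩ := hd j
  by_cases h : i = j
  · subst h
    refine ⟨fun t => - a (-t), ?_, ?_⟩
    · have hn : Tendsto (fun t : ℝ => -t) (𝓝 0) (𝓝 0) := by
        simpa using (continuous_neg (G := ℝ)).tendsto 0
      filter_upwards [hn.eventually ha] with t ht
      have := ht.comp t (hasDerivAt_neg t)
      exact hd_congr this (fun s => by simp only [Function.comp]; rw [rfl'_line_same]) (by simp)
    · have ha2 : HasDerivAt a (d i) (-0) := by simpa using ha'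
      have := (ha2.comp (0:ℝ) (hasDerivAt_neg (0:ℝ))).neg
      exact hd_congr this (fun s => rfl) (by simp)
  · refine ⟨a, ?_, ha'⟩
    filter_upwards [ha] with t ht
    exact hd_congr ht (fun s => by rw [rfl'_line_ne h]) rfl


lemma lap_le_of_max {u ψ : E → ℝ} (hu : ContDiff ℝ 2 u) {x : E} {S : ℝ} (hψ : HasLap ψ x S)
    (hm : IsLocalMax (fun y => u y - ψ y) x) : laplacian u x ≤ S := by
  have := ((hasLap_of_contDiff hu x).sub hψ).nonpos hm
  linarith

lemma lap_neg {u : E → ℝ} (hu : ContDiff ℝ 2 u) (x : E) :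
    laplacian (fun y => - u y) x = - laplacian u x := by
  have h1 := hasLap_of_contDiff hu.neg x
  have h2 := (hasLap_of_contDiff hu x).const_mul (-1)
  have h3 : HasLap (fun y => - u y) x (-1 * laplacian u x) := by
    convert h2 using 1
    ext y; ring
  rw [h1.unique h3]; ring

lemma lap_sub {u v : E → ℝ} (hu : ContDiff ℝ 2 u) (hv : ContDiff ℝ 2 v) (x : E) :
    laplacian (fun y => u y - v y) x = laplacian u x - laplacian v x :=
  (hasLap_of_contDiff (hu.sub hv) x).unique
    ((hasLap_of_contDiff hu x).sub (hasLap_of_contDiff hv x))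

lemma ac_neg {u : E → ℝ} (hu : IsACSolution u) : IsACSolution (fun y => - u y) := by
  refine ⟨hu.1.neg, fun x => ?_⟩
  rw [lap_neg hu.1]
  have := hu.2 x
  linear_combination -this

lemma ko_bound {u : E → ℝ} (hu : IsACSolution u) (z : E) (hz : 0 < u z) {R : ℝ} (hR : 0 < R) :
    u z ^ 2 ≤ 1 + (8 + 2 * n) * (1 / R ^ 2) := by
  set k : ℝ := 1 / R ^ 2 with hk
  have hkpos : 0 < k := by positivity
  have hkR : k * R ^ 2 = 1 := by rw [hk]; field_simp
  have huc : Continuous u := hu.1.continuous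
  have hcont : ContinuousOn (fun x => u x * (1 - k * ‖x - z‖ ^ 2)) (Metric.closedBall z R) := by
    apply Continuous.continuousOn; fun_prop
  obtain ⟨x, hx, hmax⟩ := (isCompact_closedBall z R).exists_isMaxOn
    ⟨z, Metric.mem_closedBall_self hR.le⟩ hcont
  set m := u x * (1 - k * ‖x - z‖ ^ 2) with hm
  have hmz : u z ≤ m := by
    have := hmax (Metric.mem_closedBall_self hR.le)
    simpa using this
  have hmpos : 0 < m := hz.trans_le hmz
  have hxn : ‖x - z‖ ≤ R := by simpa [dist_eq_norm] using hx
  have hs0 : 0 ≤ 1 - k * ‖x - z‖ ^ 2 := by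
    have : ‖x - z‖ ^ 2 ≤ R ^ 2 := by gcongr
    nlinarith
  have hs : 0 < 1 - k * ‖x - z‖ ^ 2 := by
    rcases hs0.lt_or_eq with h | h
    · exact h
    · rw [← h, mul_zero] at hm; linarith
  have hux : u x = m * (1 - k * ‖x - z‖ ^ 2)⁻¹ := by
    rw [hm]; field_simp
  have hlt : ‖x - z‖ < R := by
    by_contra hcon
    have : R ^ 2 ≤ ‖x - z‖ ^ 2 := by gcongr; linarith
    nlinarith
  have hev : ∀ᶠ y in 𝓝 x, 0 < 1 - k * ‖y - z‖ ^ 2 := by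
    have : Continuous (fun y : E => 1 - k * ‖y - z‖ ^ 2) := by fun_prop
    exact this.continuousAt.eventually (lt_mem_nhds hs)
  have hlm : IsLocalMax (fun y => u y - m * (1 - k * ‖y - z‖ ^ 2)⁻¹) x := by
    have hb : Metric.closedBall z R ∈ 𝓝 x :=
      Metric.closedBall_mem_nhds_of_mem (by simpa [dist_eq_norm] using hlt)
    filter_upwards [hev, hb] with y hy hyb
    have h1 := hmax hyb
    simp only [mem_ofPred_eq] at h1
    change u y - m * (1 - k * ‖y - z‖ ^ 2)⁻¹ ≤ u x - m * (1 - k * ‖x - z‖ ^ 2)⁻¹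
    rw [hux, sub_self, sub_nonpos, ← div_eq_mul_inv, le_div_iff₀ hy]
    exact h1
  have hd1 : ∀ s : ℝ, HasDerivAt (fun s : ℝ => 1 - k * s) (-k) s := fun s => by
    simpa using ((hasDerivAt_id s).const_mul k).const_sub 1
  have hlap := hasLap_radial (F := fun s => (1 - k * s)⁻¹)
    (F' := fun s => k * ((1 - k * s) ^ 2)⁻¹)
    (F'' := 2 * k ^ 2 * ((1 - k * ‖x - z‖ ^ 2) ^ 3)⁻¹) x z ?_ ?_
  · have hle := lap_le_of_max hu.1 (hlap.const_mul m) hlm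
    have hpde := hu.2 x
    set s := 1 - k * ‖x - z‖ ^ 2 with hsdef
    have hρ : k * ‖x - z‖ ^ 2 = 1 - s := by rw [hsdef]; ring
    have e1 : 4 * (2 * k ^ 2 * (s ^ 3)⁻¹) * ‖x - z‖ ^ 2 + 2 * n * (k * (s ^ 2)⁻¹)
        = (8 * k * (1 - s) + 2 * n * k * s) * (s ^ 3)⁻¹ := by
      rw [← hρ]; field_simp; ring
    rw [e1] at hle
    have e2 : laplacian u x = (m ^ 3 - m * s ^ 2) * (s ^ 3)⁻¹ := by
      have : laplacian u x = u x ^ 3 - u x := by linarith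
      rw [this, hux]; field_simp
    rw [e2, ← mul_assoc] at hle
    have h3 : m ^ 3 - m * s ^ 2 ≤ m * (8 * k * (1 - s) + 2 * n * k * s) :=
      le_of_mul_le_mul_right hle (by positivity)
    have h4 : m ^ 2 - s ^ 2 ≤ 8 * k * (1 - s) + 2 * n * k * s := by
      refine le_of_mul_le_mul_left ?_ hmpos
      linarith
    have hs1 : s ≤ 1 := by
      have : 0 ≤ k * ‖x - z‖ ^ 2 := by positivity
      linarith
    have h5 : u z ^ 2 ≤ m ^ 2 := by gcongr
    have h6 : (n:ℝ) * k * s ≤ n * k := mul_le_of_le_one_right (by positivity) hs1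
    have h7 : s ^ 2 ≤ 1 := by nlinarith
    have h8 : 0 ≤ k * s := by positivity
    linarith
  · have hne : ∀ᶠ s in 𝓝 (‖x - z‖ ^ 2), 1 - k * s ≠ 0 := by
      have : Continuous (fun s : ℝ => 1 - k * s) := by fun_prop
      exact this.continuousAt.eventually_ne hs.ne'
    filter_upwards [hne] with s hs'
    refine hd_congr ((hd1 s).inv hs') (fun _ => rfl) ?_
    field_simp
  · have hne : (1 - k * ‖x - z‖ ^ 2) ^ 2 ≠ 0 := by positivity
    refine hd_congr ((((hd1 (‖x - z‖ ^ 2)).pow 2).inv hne).const_mul k) (fun _ => rfl) ?_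
    have := hs.ne'
    field_simp
    norm_num
    ring

lemma ac_le_one {u : E → ℝ} (hu : IsACSolution u) (z : E) : u z ≤ 1 := by
  by_contra hz
  push Not at hz
  have hC : (0:ℝ) < 8 + 2 * n := by positivity
  set ε := u z ^ 2 - 1 with hε
  have hεpos : 0 < ε := by nlinarith
  set R := Real.sqrt (2 * (8 + 2 * n) / ε) with hR
  have hRpos : 0 < R := Real.sqrt_pos.2 (by positivity)
  have h := ko_bound hu z (by linarith) hRpos
  rw [hR, Real.sq_sqrt (by positivity)] at h
  have : (8 + 2 * (n:ℝ)) * (1 / (2 * (8 + 2 * n) / ε)) = ε / 2 := by field_simp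
  rw [this] at h
  linarith

lemma ac_abs_le {u : E → ℝ} (hu : IsACSolution u) (z : E) : |u z| ≤ 1 := by
  rw [abs_le]
  have := ac_le_one (ac_neg hu) z
  exact ⟨by linarith, ac_le_one hu z⟩

/-- A solution positive on a large ball is at least `3/4` at the centre. -/
lemma big_ball {u : E → ℝ} (hu : IsACSolution u) (z : E) {R : ℝ} (hR : 2 * ((n:ℝ) + 2) ≤ R)
    (hpos : ∀ x ∈ Metric.closedBall z R, 0 < u x) : 3 / 4 ≤ u z := by
  by_contra hcon
  push Not at hcon
  have hRpos : 0 < R := by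
    have : (0:ℝ) ≤ n := by positivity
    linarith
  set k : ℝ := 1 / R ^ 2 with hk
  have hkpos : 0 < k := by positivity
  have hkR : k * R ^ 2 = 1 := by rw [hk]; field_simp
  have huc : Continuous u := hu.1.continuous
  have hcont : ContinuousOn (fun x => (1 - k * ‖x - z‖ ^ 2) ^ 2 / u x) (Metric.closedBall z R) := by
    apply ContinuousOn.div
    · apply Continuous.continuousOn; fun_prop
    · exact huc.continuousOn
    · intro x hx; exact (hpos x hx).ne'
  have hzm : z ∈ Metric.closedBall z R := Metric.mem_closedBall_self hRpos.le
  obtain ⟨x, hx, hmax⟩ := (isCompact_closedBall z R).exists_isMaxOn ⟨z, hzm⟩ hcont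
  have huz := hpos z hzm
  have hux := hpos x hx
  set t := u x / (1 - k * ‖x - z‖ ^ 2) ^ 2 with ht
  have hxn : ‖x - z‖ ≤ R := by simpa [dist_eq_norm] using hx
  have hs0 : 0 ≤ 1 - k * ‖x - z‖ ^ 2 := by
    have : ‖x - z‖ ^ 2 ≤ R ^ 2 := by gcongr
    nlinarith
  have hz1 : 1 / u z ≤ (1 - k * ‖x - z‖ ^ 2) ^ 2 / u x := by
    have := hmax hzm
    simpa using this
  have hs : 0 < 1 - k * ‖x - z‖ ^ 2 := by
    rcases hs0.lt_or_eq with h | h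
    · exact h
    · rw [← h] at hz1
      have : 0 < 1 / u z := by positivity
      simp at hz1; linarith
  have htpos : 0 < t := by positivity
  have htz : t ≤ u z := by
    rw [div_le_div_iff₀ huz hux] at hz1
    rw [ht, div_le_iff₀ (by positivity)]; linarith
  have huxt : u x = t * (1 - k * ‖x - z‖ ^ 2) ^ 2 := by rw [ht]; field_simp
  have hlt : ‖x - z‖ < R := by
    by_contra hcon
    have : R ^ 2 ≤ ‖x - z‖ ^ 2 := by gcongr; linarith
    nlinarith
  have hlm : IsLocalMax (fun y => - u y - (-t) * (1 - k * ‖y - z‖ ^ 2) ^ 2) x := by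
    have hb : Metric.closedBall z R ∈ 𝓝 x :=
      Metric.closedBall_mem_nhds_of_mem (by simpa [dist_eq_norm] using hlt)
    filter_upwards [hb] with y hyb
    have h1 := hmax hyb
    have huy := hpos y hyb
    simp only [mem_ofPred_eq] at h1
    rw [div_le_div_iff₀ huy hux] at h1
    have h2 : t * (1 - k * ‖y - z‖ ^ 2) ^ 2 ≤ u y := by
      rw [ht, div_mul_eq_mul_div, div_le_iff₀ (by positivity)]; linarith
    rw [huxt]; linarith
  have hd1 : ∀ s : ℝ, HasDerivAt (fun s : ℝ => 1 - k * s) (-k) s := fun s => by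
    simpa using ((hasDerivAt_id s).const_mul k).const_sub 1
  have hlap := hasLap_radial (F := fun s => (1 - k * s) ^ 2)
    (F' := fun s => -2 * k * (1 - k * s)) (F'' := 2 * k ^ 2) x z
    (Eventually.of_forall fun s => hd_congr ((hd1 s).pow 2) (fun _ => rfl) (by simp; ring))
    (hd_congr ((hd1 (‖x - z‖ ^ 2)).const_mul (-2 * k)) (fun _ => rfl) (by ring))
  have hle := lap_le_of_max hu.1.neg (hlap.const_mul (-t)) hlm
  have e0 : laplacian (fun y => -u y) x = - laplacian u x := lap_neg hu.1 x
  have hpde := hu.2 x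
  rw [e0, hpde] at hle
  set s := 1 - k * ‖x - z‖ ^ 2 with hsdef
  have hρ : k * ‖x - z‖ ^ 2 = 1 - s := by rw [hsdef]; ring
  have e1 : 4 * (2 * k ^ 2) * ‖x - z‖ ^ 2 + 2 * n * (-2 * k * s)
      = k * (8 - (8 + 4 * n) * s) := by
    linear_combination (8 * k) * hρ
  rw [e1, huxt] at hle
  have h3 : s ^ 2 - t ^ 2 * s ^ 6 ≤ - (k * (8 - (8 + 4 * n) * s)) := by
    refine le_of_mul_le_mul_left ?_ htpos
    linarith
  have h4 : -(k * (8 - (8 + 4 * n) * s)) ≤ k * ((n + 2) ^ 2 / 2 * s ^ 2) := by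
    have : 0 ≤ k * (1 / 2 * (4 - (n + 2) * s) ^ 2) := by positivity
    linarith
  have h5 : k * ((n:ℝ) + 2) ^ 2 ≤ 1 / 4 := by
    have : (2 * ((n:ℝ) + 2)) ^ 2 ≤ R ^ 2 := by gcongr
    have : k * (2 * ((n:ℝ) + 2)) ^ 2 ≤ k * R ^ 2 := by gcongr
    linarith
  have h6 : s ^ 2 - t ^ 2 * s ^ 6 ≤ 1 / 8 * s ^ 2 := by
    have : k * ((n:ℝ) + 2) ^ 2 * s ^ 2 ≤ 1 / 4 * s ^ 2 := by gcongr
    linarith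
  have h7 : 1 - t ^ 2 * s ^ 4 ≤ 1 / 8 := by
    refine le_of_mul_le_mul_left ?_ (by positivity : 0 < s ^ 2)
    linarith
  have hs1 : s ≤ 1 := by
    have : 0 ≤ k * ‖x - z‖ ^ 2 := by positivity
    linarith
  have h8 : t ^ 2 * s ^ 4 ≤ t ^ 2 := mul_le_of_le_one_right (by positivity) (pow_le_one₀ hs.le hs1)
  nlinarith

/-- Comparison principle on the whole space. -/
lemma comparison {u v : E → ℝ} (hu : IsACSolution u) (hv : IsACSolution v)
    (h : ∀ x, u x < v x → 3 / 4 ≤ u x ∨ v x ≤ -(3 / 4)) (x₀ : E) : v x₀ ≤ u x₀ := by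
  by_contra hcon
  push Not at hcon
  set δ := v x₀ - u x₀ with hδ
  have hδpos : 0 < δ := by linarith
  set ε := δ / (2 * (‖x₀‖ ^ 2 + 4 * n + 1)) with hε
  have hεpos : 0 < ε := by positivity
  have hεeq : ε * (2 * (‖x₀‖ ^ 2 + 4 * n + 1)) = δ := by rw [hε]; field_simp
  set R := max ‖x₀‖ (2 / ε + 1) with hR
  have hRx : ‖x₀‖ ≤ R := le_max_left _ _
  have hR1 : 2 / ε + 1 ≤ R := le_max_right _ _
  have h2ε : 0 < 2 / ε := by positivity
  have hRε : 2 ≤ ε * R ^ 2 := by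
    have : 2 / ε ≤ R ^ 2 := by nlinarith
    rwa [div_le_iff₀' hεpos] at this
  have huc : Continuous u := hu.1.continuous
  have hvc : Continuous v := hv.1.continuous
  have hcont : Continuous (fun x => v x - u x - ε * ‖x - 0‖ ^ 2) := by fun_prop
  have hx₀ : x₀ ∈ Metric.closedBall (0:E) R := by simpa using hRx
  obtain ⟨x, hx, hmax⟩ := (isCompact_closedBall (0:E) R).exists_isMaxOn ⟨x₀, hx₀⟩ hcont.continuousOn
  have h0 := hmax hx₀
  simp only [mem_ofPred_eq, sub_zero] at h0
  have hlt : ‖x‖ < R := by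
    by_contra hc
    have : R ^ 2 ≤ ‖x‖ ^ 2 := by
      have : 0 ≤ R := (norm_nonneg _).trans hRx
      gcongr; linarith
    have h1 : ε * R ^ 2 ≤ ε * ‖x‖ ^ 2 := by gcongr
    have h2 := abs_le.1 (ac_abs_le hu x)
    have h3 := abs_le.1 (ac_abs_le hv x)
    nlinarith
  have hlm : IsLocalMax (fun x => v x - u x - ε * ‖x - 0‖ ^ 2) x :=
    hmax.isLocalMax (Metric.closedBall_mem_nhds_of_mem (by simpa using hlt))
  have hlap := hasLap_radial (F := fun s => s) (F' := fun s => 1) (F'' := 0) x 0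
    (Eventually.of_forall fun s => hasDerivAt_id s) (hasDerivAt_const _ _)
  have hle := lap_le_of_max (hv.1.sub hu.1) (hlap.const_mul ε) hlm
  have e0 : laplacian (fun y => v y - u y) x = laplacian v x - laplacian u x := lap_sub hv.1 hu.1 x
  rw [e0] at hle
  have e1 := hu.2 x
  have e2 := hv.2 x
  have hxp : 0 ≤ ε * ‖x‖ ^ 2 := by positivity
  have hw : 0 < v x - u x := by nlinarith
  have hq : 3 / 2 ≤ u x ^ 2 + u x * v x + v x ^ 2 := by
    rcases h x (by linarith) with h1 | h1 <;> nlinarith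
  have : (v x - u x) * (3 / 2) ≤ (v x - u x) * (u x ^ 2 + u x * v x + v x ^ 2) := by gcongr
  nlinarith


lemma rfl'_norm (i : Fin n) (x x₀ : E) : ‖rfl' i (x₀ i) x - x₀‖ = ‖x - x₀‖ := by
  have h : rfl' i (x₀ i) x = x + (-(2 * (x i - x₀ i))) • ev i := by
    simp only [rfl']; module
  have h2 : ‖rfl' i (x₀ i) x - x₀‖ ^ 2 = ‖x - x₀‖ ^ 2 := by
    rw [h, norm_line]
    simp only [PiLp.sub_apply]
    ring
  exact (pow_left_inj₀ (norm_nonneg _) (norm_nonneg _) (by norm_num)).1 h2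

lemma grad_barrier {g : E → ℝ} (hg : ContDiff ℝ 2 g) (x₀ : E) (i : Fin n) {M N B : ℝ}
    (hM : ∀ x ∈ Metric.closedBall x₀ 1, |g x| ≤ M)
    (hN : ∀ x ∈ Metric.closedBall x₀ 1, |laplacian g x| ≤ N)
    (hB : 2 * n * M + N < B) {t : ℝ} (ht0 : 0 ≤ t) (ht1 : t ≤ 1) :
    g (x₀ + t • ev i) - g (x₀ + (-t) • ev i) ≤ 2 * M * t ^ 2 + B * (t - t ^ 2) := by
  have hgc := hg.continuous
  have hx₀ : x₀ ∈ Metric.closedBall x₀ (1:ℝ) := Metric.mem_closedBall_self (by norm_num)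
  have hM0 : 0 ≤ M := (abs_nonneg _).trans (hM x₀ hx₀)
  have hN0 : 0 ≤ N := (abs_nonneg _).trans (hN x₀ hx₀)
  have hB0 : 0 ≤ B := by
    have : 0 ≤ 2 * n * M := by positivity
    linarith
  set c := x₀ i with hc
  have hσc : Continuous (rfl' i c) := by unfold rfl'; fun_prop
  set Φ : E → ℝ := fun x => (g x - g (rfl' i c x))
    - (2 * M * ‖x - x₀‖ ^ 2 + B * ((x i - c) - (x i - c) ^ 2)) with hΦ
  have hΦc : Continuous Φ := by fun_prop
  set K : Set E := Metric.closedBall x₀ 1 ∩ {x | c ≤ x i} with hK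
  have hKc : IsCompact K := (isCompact_closedBall x₀ 1).inter_right
    (isClosed_le continuous_const (by fun_prop))
  have hx₀K : x₀ ∈ K := ⟨hx₀, by simp [hc]⟩
  obtain ⟨x, hxK, hmax⟩ := hKc.exists_isMaxOn ⟨x₀, hx₀K⟩ hΦc.continuousOn
  have hball : ∀ y ∈ Metric.closedBall x₀ (1:ℝ), rfl' i c y ∈ Metric.closedBall x₀ (1:ℝ) := by
    intro y hy
    rw [mem_closedBall_iff_norm] at hy ⊢
    rw [hc, rfl'_norm]; exact hy
  have key : Φ x ≤ 0 := by
    by_contra hpos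
    push Not at hpos
    have hxn : ‖x - x₀‖ ≤ 1 := by simpa [dist_eq_norm] using hxK.1
    have hy0 : 0 ≤ x i - c := sub_nonneg.2 hxK.2
    have hy1 : x i - c ≤ 1 := by
      have := PiLp.norm_apply_le (x - x₀) i
      have h2 : x i - c ≤ ‖(x - x₀) i‖ := by simpa [hc] using le_abs_self (x i - x₀ i)
      linarith
    have hyy : 0 ≤ B * ((x i - c) - (x i - c) ^ 2) := by
      apply mul_nonneg hB0; nlinarith
    have hypos : 0 < x i - c := by
      rcases hy0.lt_or_eq with h | h
      · exact h
      · exfalso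
        have : rfl' i c x = x := by simp [rfl', ← h]
        have h3 : 0 ≤ 2 * M * ‖x - x₀‖ ^ 2 := by positivity
        simp only [hΦ, this] at hpos
        linarith
    have hlt : ‖x - x₀‖ < 1 := by
      rcases hxn.lt_or_eq with h | h
      · exact h
      · exfalso
        have h1 := abs_le.1 (hM x hxK.1)
        have h2 := abs_le.1 (hM _ (hball x hxK.1))
        simp only [hΦ, h] at hpos
        linarith
    have hKn : K ∈ 𝓝 x := by
      refine inter_mem (Metric.closedBall_mem_nhds_of_mem (by simpa [dist_eq_norm] using hlt)) ?_
      have : Continuous (fun y : E => y i) := by fun_prop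
      filter_upwards [this.continuousAt.eventually (lt_mem_nhds (sub_pos.1 hypos))] with y hy
      exact le_of_lt hy
    have hlm : IsLocalMax Φ x := hmax.isLocalMax hKn
    have l1 := hasLap_of_contDiff hg x
    have l2 := (hasLap_of_contDiff hg (rfl' i c x)).refl i c
    have l3 := (hasLap_radial (F := fun s => s) (F' := fun s => 1) (F'' := 0) x x₀
      (Eventually.of_forall fun s => hasDerivAt_id s) (hasDerivAt_const _ _)).const_mul (2 * M)
    have hd : ∀ s : ℝ, HasDerivAt (fun s : ℝ => s - c) 1 s := fun s =>
      (hasDerivAt_id s).sub_const c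
    have l4 := (hasLap_coord (F := fun s => (s - c) - (s - c) ^ 2)
      (F' := fun s => 1 - 2 * (s - c)) (F'' := -2) i x
      (fun s => hd_congr ((hd s).sub ((hd s).pow 2)) (fun _ => rfl) (by simp))
      (hd_congr (((hd (x i)).const_mul 2).const_sub 1) (fun _ => rfl) (by ring))).const_mul B
    have := ((l1.sub l2).sub (l3.add l4)).nonpos hlm
    have b1 := abs_le.1 (hN x hxK.1)
    have b2 := abs_le.1 (hN _ (hball x hxK.1))
    linarith
  have htK : x₀ + t • ev i ∈ K := by
    refine ⟨?_, ?_⟩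
    · rw [mem_closedBall_iff_norm]
      simp [norm_smul, abs_of_nonneg ht0, ht1]
    · simp [hc, ht0]
  have h1 : Φ (x₀ + t • ev i) ≤ 0 := (hmax htK).trans key
  have h2 : rfl' i c (x₀ + t • ev i) = x₀ + (-t) • ev i := by
    rw [rfl'_line_same]; congr 1; simp [rfl', hc]
  have h3 : ‖x₀ + t • ev i - x₀‖ ^ 2 = t ^ 2 := by
    simp [norm_smul]
  have h4 : (x₀ + t • ev i) i - c = t := by simp [hc]
  simp only [hΦ, h2, h3, h4] at h1
  linarith

lemma grad_le {g : E → ℝ} (hg : ContDiff ℝ 2 g) (x₀ : E) (i : Fin n) {M N : ℝ}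
    (hM : ∀ x ∈ Metric.closedBall x₀ 1, |g x| ≤ M)
    (hN : ∀ x ∈ Metric.closedBall x₀ 1, |laplacian g x| ≤ N) :
    fderiv ℝ g x₀ (ev i) ≤ n * M + N := by
  have hx₀ : x₀ ∈ Metric.closedBall x₀ (1:ℝ) := Metric.mem_closedBall_self (by norm_num)
  have hN0 : 0 ≤ N := (abs_nonneg _).trans (hN x₀ hx₀)
  suffices h : ∀ B, 2 * n * M + N < B → 2 * fderiv ℝ g x₀ (ev i) ≤ B by
    have := le_of_forall_gt_imp_ge_of_dense h
    linarith
  intro B hB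
  set D := fderiv ℝ g x₀ (ev i) with hD
  have hgd := hg.differentiable (by norm_num)
  have h1 : HasDerivAt (fun s : ℝ => g (x₀ + s • ev i)) D 0 := by
    have h := (hgd (x₀ + (0:ℝ) • ev i)).hasFDerivAt
    exact hd_congr (h.comp_hasDerivAt (0:ℝ) (line_hasDerivAt x₀ i 0)) (fun _ => rfl) (by simp [hD])
  have h2 : HasDerivAt (fun s : ℝ => g (x₀ + (-s) • ev i)) (-D) 0 := by
    have h1' : HasDerivAt (fun s : ℝ => g (x₀ + s • ev i)) D (-0) := by simpa using h1
    exact hd_congr (h1'.comp (0:ℝ) (hasDerivAt_neg (0:ℝ))) (fun _ => rfl) (by simp)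
  have h3 : HasDerivAt (fun s : ℝ => 2 * M * s ^ 2 + B * (s - s ^ 2)) B 0 := by
    have a1 := hasDerivAt_pow 2 (0:ℝ)
    exact hd_congr ((a1.const_mul (2 * M)).add (((hasDerivAt_id (0:ℝ)).sub a1).const_mul B))
      (fun _ => rfl) (by simp)
  have h4 := ((h1.sub h2).sub h3).tendsto_slope_zero_right
  have h5 : D - -D - B ≤ 0 := by
    refine le_of_tendsto h4 ?_
    have : Ioo (0:ℝ) 1 ∈ 𝓝[>] (0:ℝ) := Ioo_mem_nhdsGT (by norm_num)
    filter_upwards [this] with t ht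
    have := grad_barrier hg x₀ i hM hN hB ht.1.le ht.2.le
    simp only [smul_eq_mul, Pi.sub_apply, zero_add]
    refine mul_nonpos_of_nonneg_of_nonpos (inv_nonneg.2 ht.1.le) ?_
    simp
    simp at this
    linarith
  linarith

lemma grad_abs {g : E → ℝ} (hg : ContDiff ℝ 2 g) (x₀ : E) (i : Fin n) {M N : ℝ}
    (hM : ∀ x ∈ Metric.closedBall x₀ 1, |g x| ≤ M)
    (hN : ∀ x ∈ Metric.closedBall x₀ 1, |laplacian g x| ≤ N) :
    |fderiv ℝ g x₀ (ev i)| ≤ n * M + N := by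
  have h1 := grad_le hg x₀ i hM hN
  have h2 := grad_le hg.neg x₀ i (M := M) (N := N) (by simpa using hM)
    (fun x hx => by
      have : laplacian (fun y => - g y) x = - laplacian g x := lap_neg hg x
      rw [this, abs_neg]; exact hN x hx)
  rw [fderiv_fun_neg] at h2
  simp at h2
  rw [abs_le]
  constructor <;> linarith

/-- quantitative strong maximum principle -/
lemma barrier_low {w : E → ℝ} (hw : ContDiff ℝ 2 w) (h0 : ∀ x, 0 ≤ w x)
    (hl : ∀ x, laplacian w x ≤ 2 * w x) {η ρ R : ℝ} (hη : 0 < η) (hρ : 0 < ρ) (hR : 0 < R) :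
    ∃ c > 0, ∀ z, (∀ x ∈ Metric.closedBall z ρ, η ≤ w x) →
      ∀ x ∈ Metric.closedBall z R, c ≤ w x := by
  set α := ((n:ℝ) + 2) / ρ ^ 2 + 1 with hα
  have hα1 : 1 ≤ α := by
    have : 0 ≤ ((n:ℝ) + 2) / ρ ^ 2 := by positivity
    linarith
  have hαρ : (n:ℝ) + 2 ≤ α * ρ ^ 2 := by
    rw [hα, add_mul, div_mul_cancel₀ _ (by positivity)]
    have : 0 < ρ ^ 2 := by positivity
    linarith
  set eR := Real.exp (-α * (R + 1) ^ 2) with heR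
  refine ⟨η * (Real.exp (-α * R ^ 2) - eR), ?_, ?_⟩
  · refine mul_pos hη (sub_pos.2 (Real.exp_lt_exp.2 ?_))
    nlinarith
  intro z hz
  set φ : E → ℝ := fun x => η * (Real.exp (-α * ‖x - z‖ ^ 2) - eR) with hφ
  have hwc := hw.continuous
  have hφc : Continuous (fun x => φ x - w x) := by fun_prop
  have hzm : z ∈ Metric.closedBall z (R + 1) := Metric.mem_closedBall_self (by linarith)
  obtain ⟨x, hx, hmax⟩ := (isCompact_closedBall z (R + 1)).exists_isMaxOn ⟨z, hzm⟩ hφc.continuousOn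
  have key : φ x - w x ≤ 0 := by
    by_contra hpos
    push Not at hpos
    have hxn : ‖x - z‖ ≤ R + 1 := by simpa [dist_eq_norm] using hx
    have hlt : ‖x - z‖ < R + 1 := by
      rcases hxn.lt_or_eq with h | h
      · exact h
      · exfalso
        have := h0 x
        simp only [hφ, h, heR, sub_self, mul_zero] at hpos
        linarith
    have hgt : ρ < ‖x - z‖ := by
      by_contra hc
      have h1 := hz x (by rw [mem_closedBall_iff_norm]; linarith)
      have h2 : Real.exp (-α * ‖x - z‖ ^ 2) ≤ 1 := by
        rw [Real.exp_le_one_iff]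
        have : 0 ≤ α * ‖x - z‖ ^ 2 := by positivity
        linarith
      have h3 : 0 < eR := Real.exp_pos _
      have h4 : η * (Real.exp (-α * ‖x - z‖ ^ 2) - eR) ≤ η * 1 := by gcongr; linarith
      simp only [hφ] at hpos
      linarith
    have hlm : IsLocalMax (fun x => φ x - w x) x :=
      hmax.isLocalMax (Metric.closedBall_mem_nhds_of_mem (by simpa [dist_eq_norm] using hlt))
    have hd : ∀ s : ℝ, HasDerivAt (fun s : ℝ => Real.exp (-α * s)) (-α * Real.exp (-α * s)) s := by
      intro s
      exact hd_congr (((hasDerivAt_id s).const_mul (-α)).exp) (fun _ => rfl) (by simp; ring)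
    have l1 := hasLap_radial (F := fun s => Real.exp (-α * s) - eR)
      (F' := fun s => -α * Real.exp (-α * s))
      (F'' := -α * (-α * Real.exp (-α * ‖x - z‖ ^ 2))) x z
      (Eventually.of_forall fun s => (hd s).sub_const eR) ((hd _).const_mul (-α))
    have := ((l1.const_mul η).sub (hasLap_of_contDiff hw x)).nonpos hlm
    have hlx := hl x
    set e := Real.exp (-α * ‖x - z‖ ^ 2) with he
    have hepos : 0 < e := Real.exp_pos _
    have heRpos : 0 < eR := Real.exp_pos _
    have h5 : (n:ℝ) + 2 ≤ α * ‖x - z‖ ^ 2 := hαρ.trans (by gcongr)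
    have h6 : 2 ≤ α * (4 * (α * ‖x - z‖ ^ 2) - 2 * n) := by
      have : (0:ℝ) ≤ n := by positivity
      nlinarith
    have h7 : 2 * (η * e) ≤ α * (4 * (α * ‖x - z‖ ^ 2) - 2 * n) * (η * e) := by gcongr
    have h8 : 0 < η * eR := by positivity
    simp only [hφ, ← he] at hpos
    nlinarith
  intro y hy
  have hyn : ‖y - z‖ ≤ R := by simpa [dist_eq_norm] using hy
  have hyK : y ∈ Metric.closedBall z (R + 1) := by rw [mem_closedBall_iff_norm]; linarith
  have h1 := (hmax hyK).trans key
  simp only [] at h1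
  have h2 : η * (Real.exp (-α * R ^ 2) - eR) ≤ φ y := by
    simp only [hφ]
    gcongr η * (Real.exp ?_ - eR)
    have : ‖y - z‖ ^ 2 ≤ R ^ 2 := by gcongr
    nlinarith
  linarith

lemma small_spread {w : E → ℝ} (hw : ContDiff ℝ 2 w) (h0 : ∀ x, 0 ≤ w x)
    (hl : ∀ x, laplacian w x ≤ 2 * w x) {Λ : ℝ} (hΛ : 0 < Λ)
    (hlip : ∀ x y, |w x - w y| ≤ Λ * ‖x - y‖) {η R : ℝ} (hη : 0 < η) (hR : 0 < R) :
    ∃ δ > 0, ∀ x₀, w x₀ < δ → ∀ x ∈ Metric.closedBall x₀ R, w x < η := by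
  obtain ⟨c, hc, h⟩ := barrier_low hw h0 hl (η := η / 2) (ρ := η / (2 * Λ)) (R := R)
    (by positivity) (by positivity) hR
  refine ⟨c, hc, fun x₀ hx₀ x hx => ?_⟩
  by_contra hcon
  push Not at hcon
  have := h x (fun y hy => by
    rw [mem_closedBall_iff_norm] at hy
    have h1 := (abs_le.1 (hlip y x)).1
    have h2 : Λ * ‖y - x‖ ≤ Λ * (η / (2 * Λ)) := by gcongr
    have h3 : Λ * (η / (2 * Λ)) = η / 2 := by field_simp
    linarith) x₀ (by rw [Metric.mem_closedBall, dist_comm]; exact hx)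
  linarith


lemma clm_norm_le {F : Type*} [NormedAddCommGroup F] [NormedSpace ℝ F] (A : E →L[ℝ] F) {C : ℝ}
    (hC : 0 ≤ C) (h : ∀ i, ‖A (ev i)‖ ≤ C) : ‖A‖ ≤ n * C := by
  refine A.opNorm_le_bound (by positivity) fun x => ?_
  have hx : x = ∑ i, x i • ev i := by
    ext j
    simp [Pi.single_apply]
  have h1 : A x = ∑ i, x i • A (ev i) := by
    conv_lhs => rw [hx]
    simp [map_sum]
  rw [h1]
  calc ‖∑ i, x i • A (ev i)‖ ≤ ∑ i : Fin n, C * ‖x‖ := by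
        refine norm_sum_le_of_le _ fun i _ => ?_
        rw [norm_smul, mul_comm]
        have := PiLp.norm_apply_le x i
        exact mul_le_mul (h i) this (norm_nonneg _) hC
    _ = n * C * ‖x‖ := by simp [mul_assoc]

lemma HasLap.translate {g : E → ℝ} {x a : E} {S : ℝ} (hg : HasLap g (x + a) S) :
    HasLap (fun y => g (y + a)) x S := by
  obtain ⟨d, rfl, hd⟩ := hg
  refine ⟨d, rfl, fun i => ?_⟩
  obtain ⟨b, hb, hb'⟩ := hd i
  refine ⟨b, ?_, hb'⟩
  filter_upwards [hb] with t ht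
  exact hd_congr ht (fun s => by rw [add_right_comm]) rfl

lemma lap_translate {w : E → ℝ} (hw : ContDiff ℝ 2 w) (x a : E) :
    laplacian (fun y => w (y + a)) x = laplacian w (x + a) :=
  (hasLap_of_contDiff (hw.comp (contDiff_id.add contDiff_const)) x).unique
    (hasLap_of_contDiff hw (x + a)).translate

lemma dir_mvt {f : E → ℝ} (hf : Differentiable ℝ f) (x : E) (j : Fin n) {C : ℝ}
    (hC : ∀ s ∈ Icc (-1:ℝ) 1, |fderiv ℝ f (x + s • ev j) (ev j)| ≤ C) {h : ℝ}
    (hh : h ∈ Icc (-1:ℝ) 1) : |f (x + h • ev j) - f x| ≤ C * |h| := by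
  have hd : ∀ s ∈ Icc (-1:ℝ) 1, HasDerivWithinAt (fun s : ℝ => f (x + s • ev j))
      (fderiv ℝ f (x + s • ev j) (ev j)) (Icc (-1:ℝ) 1) s := fun s _ =>
    ((hf _).hasFDerivAt.comp_hasDerivAt s (line_hasDerivAt x j s)).hasDerivWithinAt
  have := (convex_Icc (-1:ℝ) 1).norm_image_sub_le_of_norm_hasDerivWithin_le hd
    (fun s hs => by simpa using hC s hs) (x := 0) (y := h) (by norm_num) hh
  simpa using this

lemma ac_lap {u : E → ℝ} (hu : IsACSolution u) (x : E) : laplacian u x = u x ^ 3 - u x := by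
  have := hu.2 x
  linarith

lemma ac_grad {u : E → ℝ} (hu : IsACSolution u) (x : E) (i : Fin n) :
    |fderiv ℝ u x (ev i)| ≤ n + 2 := by
  have := grad_abs hu.1 x i (M := 1) (N := 2) (fun y _ => ac_abs_le hu y) (fun y _ => by
    rw [ac_lap hu]
    have h1 := abs_le.1 (ac_abs_le hu y)
    rw [abs_le]
    constructor <;> nlinarith [mul_nonneg (sub_nonneg.2 h1.2) (by linarith : 0 ≤ u y + 1)])
  linarith

lemma diff_lap {u v : E → ℝ} (hu : IsACSolution u) (hv : IsACSolution v) (x : E) :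
    laplacian (fun y => u y - v y) x
      = (u x - v x) * (u x ^ 2 + u x * v x + v x ^ 2 - 1) := by
  rw [lap_sub hu.1 hv.1, ac_lap hu, ac_lap hv]; ring

lemma quad_bound {a b : ℝ} (ha : |a| ≤ 1) (hb : |b| ≤ 1) : |a ^ 2 + a * b + b ^ 2 - 1| ≤ 2 := by
  have h1 := abs_le.1 ha
  have h2 := abs_le.1 hb
  rw [abs_le]
  constructor <;> nlinarith [sq_nonneg (a + b), sq_nonneg a, sq_nonneg b, sq_nonneg (a - b)]

lemma diff_lap_abs {u v : E → ℝ} (hu : IsACSolution u) (hv : IsACSolution v) (x : E) :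
    |laplacian (fun y => u y - v y) x| ≤ 2 * |u x - v x| := by
  rw [diff_lap hu hv, abs_mul, mul_comm]
  have := quad_bound (ac_abs_le hu x) (ac_abs_le hv x)
  gcongr

lemma diff_grad {u v : E → ℝ} (hu : IsACSolution u) (hv : IsACSolution v) {x : E} {η : ℝ}
    (h : ∀ y ∈ Metric.closedBall x 1, |u y - v y| ≤ η) (i : Fin n) :
    |fderiv ℝ (fun y => u y - v y) x (ev i)| ≤ (n + 2) * η := by
  have := grad_abs (hu.1.sub hv.1) x i (M := η) (N := 2 * η) h (fun y hy => by
    have h1 := diff_lap_abs hu hv y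
    have h2 := h y hy
    exact h1.trans (by linarith))
  calc _ ≤ _ := this
    _ = _ := by ring

lemma diff_lip {u v : E → ℝ} (hu : IsACSolution u) (hv : IsACSolution v) (x y : E) :
    |(u x - v x) - (u y - v y)| ≤ (n * ((n + 2) * 2) + 1) * ‖x - y‖ := by
  have hd : Differentiable ℝ (fun y => u y - v y) := (hu.1.sub hv.1).differentiable (by norm_num)
  have hb : ∀ y, ‖fderiv ℝ (fun y => u y - v y) y‖ ≤ n * ((n + 2) * 2) + 1 := by
    intro y
    have := clm_norm_le (fderiv ℝ (fun y => u y - v y) y) (C := (n + 2) * 2) (by positivity)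
      (fun i => by
        rw [Real.norm_eq_abs]
        refine diff_grad hu hv (fun z _ => ?_) i
        have h1 := abs_le.1 (ac_abs_le hu z)
        have h2 := abs_le.1 (ac_abs_le hv z)
        rw [abs_le]; constructor <;> linarith)
    linarith
  have := convex_univ.norm_image_sub_le_of_norm_fderiv_le (𝕜 := ℝ)
    (fun z _ => hd z) (fun z _ => hb z) (mem_univ y) (mem_univ x)
  simpa using this

lemma ball_line {x₀ y : E} {r s : ℝ} (j : Fin n) (hy : y ∈ Metric.closedBall x₀ r)
    (hs : s ∈ Icc (-1:ℝ) 1) : y + s • ev j ∈ Metric.closedBall x₀ (r + 1) := by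
  rw [mem_closedBall_iff_norm] at hy ⊢
  have h1 : y + s • ev j - x₀ = (y - x₀) + s • ev j := by abel
  rw [h1]
  refine (norm_add_le _ _).trans (add_le_add hy ?_)
  simp [norm_smul]
  exact abs_le.2 hs

lemma diff_hess {u v : E → ℝ} (hu : IsACSolution u) (hv : IsACSolution v) {x : E} {η : ℝ}
    (h : ∀ y ∈ Metric.closedBall x 3, |u y - v y| ≤ η) (i j : Fin n) :
    |fderiv ℝ (fderiv ℝ (fun y => u y - v y)) x (ev j) (ev i)| ≤ (n + 2) * (n + 8) * η := by
  set w : E → ℝ := fun y => u y - v y with hw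
  have hwC : ContDiff ℝ 2 w := hu.1.sub hv.1
  have hwd : Differentiable ℝ w := hwC.differentiable (by norm_num)
  have hud : Differentiable ℝ u := hu.1.differentiable (by norm_num)
  have hvd : Differentiable ℝ v := hv.1.differentiable (by norm_num)
  have hη : 0 ≤ η := (abs_nonneg _).trans (h x (Metric.mem_closedBall_self (by norm_num)))
  have hg2 : ∀ y ∈ Metric.closedBall x 2, ∀ i, |fderiv ℝ w y (ev i)| ≤ (n + 2) * η := by
    intro y hy i
    refine diff_grad hu hv (fun z hz => h z ?_) i
    rw [Metric.mem_closedBall] at *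
    linarith [dist_triangle z y x]
  -- the right-hand side
  set q : E → ℝ := fun y => (u y ^ 3 - u y) - (v y ^ 3 - v y) with hq
  have hqlap : ∀ y, laplacian w y = q y := fun y => by
    rw [hw, lap_sub hu.1 hv.1, ac_lap hu, ac_lap hv]
  have hqd : Differentiable ℝ q := ((hud.pow 3).sub hud).sub ((hvd.pow 3).sub hvd)
  have hqf : ∀ y, fderiv ℝ q y (ev j) = (3 * u y ^ 2 - 1) * fderiv ℝ w y (ev j)
      + 3 * (u y + v y) * (u y - v y) * fderiv ℝ v y (ev j) := by
    intro y
    have e1 : HasFDerivAt q _ y := (((hud y).hasFDerivAt.pow 3).sub (hud y).hasFDerivAt).sub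
      (((hvd y).hasFDerivAt.pow 3).sub (hvd y).hasFDerivAt)
    have e2 : HasFDerivAt w _ y := (hud y).hasFDerivAt.sub (hvd y).hasFDerivAt
    rw [e1.fderiv, e2.fderiv]
    simp
    ring
  have hqg : ∀ y ∈ Metric.closedBall x 2, |fderiv ℝ q y (ev j)| ≤ 8 * (n + 2) * η := by
    intro y hy
    have b1 := hg2 y hy j
    have b2 := ac_grad hv y j
    have b3 : |u y - v y| ≤ η := h y (Metric.closedBall_subset_closedBall (by norm_num) hy)
    have b4 : |3 * u y ^ 2 - 1| ≤ 2 := by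
      have := abs_le.1 (ac_abs_le hu y)
      rw [abs_le]; constructor <;> nlinarith
    have b5 : |3 * (u y + v y)| ≤ 6 := by
      have h1 := abs_le.1 (ac_abs_le hu y)
      have h2 := abs_le.1 (ac_abs_le hv y)
      rw [abs_le]; constructor <;> linarith
    rw [hqf]
    refine (abs_add_le _ _).trans ?_
    rw [abs_mul, abs_mul, abs_mul]
    have c1 : |3 * u y ^ 2 - 1| * |fderiv ℝ w y (ev j)| ≤ 2 * ((n + 2) * η) := by gcongr
    have c2 : |3 * (u y + v y)| * |u y - v y| * |fderiv ℝ v y (ev j)| ≤ 6 * η * (n + 2) := by gcongr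
    linarith
  have step : ∀ s ∈ Icc (-1:ℝ) 1,
      |fderiv ℝ w (x + s • ev j) (ev i) - fderiv ℝ w x (ev i)| ≤ (n + 2) * (n + 8) * η * |s| := by
    intro s hs
    set G : E → ℝ := fun y => w (y + s • ev j) - w y with hG
    have hwt : ContDiff ℝ 2 (fun y => w (y + s • ev j)) := hwC.comp (contDiff_id.add contDiff_const)
    have hGC : ContDiff ℝ 2 G := hwt.sub hwC
    have hin : ∀ y ∈ Metric.closedBall x 1, ∀ r ∈ Icc (-1:ℝ) 1,
        y + r • ev j ∈ Metric.closedBall x 2 := by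
      intro y hy r hr
      have := ball_line j hy hr
      norm_num at this ⊢
      exact this
    have hest := grad_abs hGC x i (M := (n + 2) * η * |s|) (N := 8 * (n + 2) * η * |s|)
      (fun y hy => dir_mvt hwd y j (fun r hr => hg2 _ (hin y hy r hr) j) hs)
      (fun y hy => by
        have e : laplacian G y = q (y + s • ev j) - q y := by
          rw [hG, lap_sub hwt hwC, lap_translate hwC, hqlap, hqlap]
        rw [e]
        exact dir_mvt hqd y j (fun r hr => hqg _ (hin y hy r hr)) hs)
    have e : fderiv ℝ G x = fderiv ℝ w (x + s • ev j) - fderiv ℝ w x := by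
      rw [hG, fderiv_fun_sub ((hwt.differentiable (by norm_num)) x) (hwd x),
        fderiv_comp_add_right]
    rw [e] at hest
    simp only [sub_apply] at hest
    calc _ ≤ _ := hest
      _ = _ := by ring
  have hd2 : Differentiable ℝ (fderiv ℝ w) :=
    (hwC.fderiv_right (m := 1) (by norm_num)).differentiable (by norm_num)
  have hder : HasDerivAt (fun s : ℝ => fderiv ℝ w (x + s • ev j) (ev i))
      (fderiv ℝ (fderiv ℝ w) x (ev j) (ev i)) 0 := by
    have h1 := (hd2 (x + (0:ℝ) • ev j)).hasFDerivAt.comp_hasDerivAt (0:ℝ) (line_hasDerivAt x j 0)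
    have h2 := h1.clm_apply (hasDerivAt_const (0:ℝ) (ev i))
    exact hd_congr h2 (fun _ => rfl) (by simp)
  have := hder.le_of_lip' (C := (n + 2) * (n + 8) * η) (by positivity) (by
    have hn : Icc (-1:ℝ) 1 ∈ 𝓝 (0:ℝ) := Icc_mem_nhds (by norm_num) (by norm_num)
    filter_upwards [hn] with s hs
    simpa using step s hs)
  simpa using this

/-- smallness at a point spreads to a ball, with two derivatives -/
lemma diff_small {u v : E → ℝ} (hu : IsACSolution u) (hv : IsACSolution v) (hvu : ∀ x, v x ≤ u x)
    {ε R : ℝ} (hε : 0 < ε) (hR : 0 < R) :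
    ∃ δ > 0, ∀ x₀, u x₀ - v x₀ < δ → ∀ x ∈ Metric.closedBall x₀ R,
      |u x - v x| < ε ∧ ‖fderiv ℝ (fun y => u y - v y) x‖ < ε ∧
      ‖fderiv ℝ (fderiv ℝ (fun y => u y - v y)) x‖ < ε := by
  set D : ℝ := 1 + n * (n + 2) + n * (n * ((n + 2) * (n + 8))) with hD
  have hDpos : 0 < D := by positivity
  set η := ε / (2 * D) with hη
  have hηpos : 0 < η := by positivity
  have hDη : D * η = ε / 2 := by rw [hη]; field_simp
  obtain ⟨δ, hδ, h⟩ := small_spread (hu.1.sub hv.1) (fun x => sub_nonneg.2 (hvu x))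
    (fun x => by
      have h1 := le_of_abs_le (diff_lap_abs hu hv x)
      rw [abs_of_nonneg (sub_nonneg.2 (hvu x))] at h1
      exact h1)
    (Λ := n * ((n + 2) * 2) + 1) (by positivity) (diff_lip hu hv) hηpos
    (by linarith : 0 < R + 3)
  refine ⟨δ, hδ, fun x₀ hx₀ x hx => ?_⟩
  have hb : ∀ y ∈ Metric.closedBall x 3, |u y - v y| ≤ η := by
    intro y hy
    rw [abs_of_nonneg (sub_nonneg.2 (hvu y))]
    refine (h x₀ hx₀ y ?_).le
    rw [Metric.mem_closedBall] at *
    linarith [dist_triangle y x x₀]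
  have t1 : 0 ≤ (n:ℝ) * (n + 2) * η := by positivity
  have t2 : 0 ≤ n * ((n:ℝ) * ((n + 2) * (n + 8))) * η := by positivity
  refine ⟨?_, ?_, ?_⟩
  · have := hb x (Metric.mem_closedBall_self (by norm_num))
    nlinarith
  · have := clm_norm_le (fderiv ℝ (fun y => u y - v y) x) (C := (n + 2) * η) (by positivity)
      (fun i => diff_grad hu hv
        (fun y hy => hb y (Metric.closedBall_subset_closedBall (by norm_num) hy)) i)
    nlinarith
  · have := clm_norm_le (fderiv ℝ (fderiv ℝ (fun y => u y - v y)) x)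
      (C := n * ((n + 2) * (n + 8) * η)) (by positivity)
      (fun j => clm_norm_le _ (by positivity) (fun i => diff_hess hu hv hb i j))
    nlinarith


lemma H_hasDeriv (t : ℝ) : HasDerivAt H ((1 - H t ^ 2) / Real.sqrt 2) t := by
  have h1 : HasDerivAt (fun t : ℝ => t / Real.sqrt 2) (1 / Real.sqrt 2) t :=
    (hasDerivAt_id t).div_const _
  have hc : Real.cosh (t / Real.sqrt 2) ≠ 0 := (Real.cosh_pos _).ne'
  have h2 := (h1.sinh).div h1.cosh hc
  refine hd_congr h2 (fun s => ?_) ?_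
  · simp [H, Real.tanh_eq_sinh_div_cosh]
  · simp only [H, Real.tanh_eq_sinh_div_cosh]
    have : Real.sqrt 2 ≠ 0 := by positivity
    field_simp

lemma H_abs (t : ℝ) : |H t| < 1 := Real.abs_tanh_lt_one _

lemma H_hasDeriv2 (t : ℝ) :
    HasDerivAt (fun s => (1 - H s ^ 2) / Real.sqrt 2) (H t ^ 3 - H t) t := by
  have h := (((H_hasDeriv t).pow 2).const_sub 1).div_const (Real.sqrt 2)
  refine hd_congr h (fun s => rfl) ?_
  have h2 : Real.sqrt 2 ^ 2 = 2 := Real.sq_sqrt (by norm_num)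
  have : Real.sqrt 2 ≠ 0 := by positivity
  field_simp
  rw [h2]; simp; ring

lemma H_contDiff : ContDiff ℝ 2 H := by
  have : H = fun t => Real.sinh (t / Real.sqrt 2) / Real.cosh (t / Real.sqrt 2) := by
    ext t; simp [H, Real.tanh_eq_sinh_div_cosh]
  rw [this]
  have h1 : ContDiff ℝ 2 (fun t : ℝ => t / Real.sqrt 2) := contDiff_id.div_const _
  exact (Real.contDiff_sinh.comp h1).div (Real.contDiff_cosh.comp h1)
    (fun t => (Real.cosh_pos _).ne')

lemma H_deriv_bound (t : ℝ) : 0 ≤ (1 - H t ^ 2) / Real.sqrt 2 ∧ (1 - H t ^ 2) / Real.sqrt 2 ≤ 1 := by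
  have h1 := abs_lt.1 (H_abs t)
  have h2 : 0 ≤ 1 - H t ^ 2 := by nlinarith
  have h3 : 1 ≤ Real.sqrt 2 := Real.one_le_sqrt.2 (by norm_num)
  refine ⟨by positivity, ?_⟩
  rw [div_le_one (by positivity)]
  nlinarith

lemma H_mono : Monotone H :=
  monotone_of_deriv_nonneg (fun t => (H_hasDeriv t).differentiableAt) (fun t => by
    rw [(H_hasDeriv t).deriv]; exact (H_deriv_bound t).1)

lemma H_lip {t s : ℝ} (hs : 0 ≤ s) : H (t + s) ≤ H t + s := by
  have := convex_univ.norm_image_sub_le_of_norm_hasDerivWithin_le (f := H) (C := 1)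
    (fun x _ => (H_hasDeriv x).hasDerivWithinAt) (fun x _ => by
      rw [Real.norm_eq_abs, abs_of_nonneg (H_deriv_bound x).1]; exact (H_deriv_bound x).2)
    (mem_univ t) (mem_univ (t + s))
  rw [Real.norm_eq_abs, Real.norm_eq_abs] at this
  have h2 := (abs_le.1 this).2
  rw [add_sub_cancel_left, abs_of_nonneg hs] at h2
  linarith

lemma H_surj {s : ℝ} (h1 : -1 < s) (h2 : s < 1) : ∃ t, H t = s := by
  refine ⟨Real.sqrt 2 * Real.artanh s, ?_⟩
  have : Real.sqrt 2 ≠ 0 := by positivity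
  rw [H, mul_div_cancel_left₀ _ this]
  exact Real.tanh_artanh ⟨h1, h2⟩

/-- the planar front -/
noncomputable def fr (p : Fin n) (a : ℝ) (x : E) : ℝ := H (-(x p) + a)

lemma fr_sol (p : Fin n) (a : ℝ) : IsACSolution (fr p a : E → ℝ) := by
  have hC : ContDiff ℝ 2 (fr p a : E → ℝ) := by
    unfold fr
    refine H_contDiff.comp ?_
    fun_prop
  refine ⟨hC, fun x => ?_⟩
  have hl : ∀ s : ℝ, HasDerivAt (fun s : ℝ => -s + a) (-1) s := fun s =>
    (hasDerivAt_neg s).add_const a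
  have h := hasLap_coord (F := fun s => H (-s + a))
    (F' := fun s => -((1 - H (-s + a) ^ 2) / Real.sqrt 2))
    (F'' := H (-(x p) + a) ^ 3 - H (-(x p) + a)) p x
    (fun s => hd_congr ((H_hasDeriv (-s + a)).comp s (hl s)) (fun _ => rfl) (by ring))
    (hd_congr ((H_hasDeriv2 (-(x p) + a)).comp (x p) (hl (x p))).neg (fun _ => rfl) (by ring))
  rw [(hasLap_of_contDiff hC x).unique h]
  simp only [fr]; ring

lemma tlu_of {X : Type*} [PseudoMetricSpace X] {F : ℕ → E → X} {f : E → X}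
    (h : ∀ ε > 0, ∀ R > 0, ∀ᶠ k in atTop, ∀ x ∈ Metric.closedBall (0:E) R, dist (f x) (F k x) < ε) :
    TendstoLocallyUniformly F f atTop := by
  rw [Metric.tendstoLocallyUniformly_iff]
  intro ε hε x
  refine ⟨Metric.closedBall 0 (‖x‖ + 1), ?_, h ε hε _ (by positivity)⟩
  exact Metric.closedBall_mem_nhds_of_mem (by simp)

theorem main_aux (u : E → ℝ) (hu : IsACSolution u) (hnc : ¬ ∃ c : ℝ, ∀ x, u x = c) (p : Fin n)
    (hpos : ∀ x : E, x p < 0 → 0 < u x) :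
    ∃ a : ℝ, (∀ x : E, fr p a x ≤ u x) ∧ ((∀ x : E, u x = fr p a x) ∨
       ((∀ x : E, fr p a x < u x) ∧
        ∃ y : ℕ → E, (∀ k, y k p = 0) ∧ Tendsto (fun k => ‖y k‖) atTop atTop ∧
          TendstoLocallyUniformly (fun k x => u (x + y k)) (fr p a) atTop ∧
          TendstoLocallyUniformly (fun k x => fderiv ℝ (fun z => u (z + y k)) x)
            (fderiv ℝ (fr p a)) atTop ∧
          TendstoLocallyUniformly (fun k x => fderiv ℝ (fderiv ℝ (fun z => u (z + y k))) x)
            (fderiv ℝ (fderiv ℝ (fr p a))) atTop)) := by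
  set K : ℝ := 2 * ((n:ℝ) + 2) with hK
  have hcoord : ∀ x : E, |x p| ≤ ‖x‖ := fun x => PiLp.norm_apply_le x p
  have hlow : ∀ x : E, x p ≤ -K - 1 → 3 / 4 ≤ u x := by
    intro x hx
    refine big_ball hu x (le_refl K) fun y hy => hpos y ?_
    rw [mem_closedBall_iff_norm] at hy
    have h1 := (abs_le.1 (hcoord (y - x))).2
    simp only [PiLp.sub_apply] at h1
    linarith
  obtain ⟨T, hT⟩ := H_surj (s := -(3 / 4)) (by norm_num) (by norm_num)
  have hfrT : ∀ (a : ℝ) (x : E), -(x p) + a ≤ T → fr p a x ≤ -(3 / 4) := by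
    intro a x h
    rw [← hT]; exact H_mono h
  set A : Set ℝ := {a | ∀ x : E, fr p a x ≤ u x} with hA
  have hAne : (T - K - 1) ∈ A := by
    intro x
    refine comparison hu (fr_sol p _) (fun x _ => ?_) x
    by_cases hx : x p ≤ -K - 1
    · exact Or.inl (hlow x hx)
    · exact Or.inr (hfrT _ _ (by linarith))
  have hHc : Continuous H := H_contDiff.continuous
  have hAbdd : BddAbove A := by
    by_contra hb
    rw [not_bddAbove_iff] at hb
    apply hnc
    refine ⟨1, fun x => le_antisymm (ac_le_one hu x) ?_⟩
    by_contra hlt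
    push Not at hlt
    have hm := abs_le.1 (ac_abs_le hu x)
    obtain ⟨t, ht⟩ := H_surj (s := (u x + 1) / 2) (by linarith) (by linarith)
    obtain ⟨a, haA, ha⟩ := hb (t + x p)
    have h1 : H t ≤ fr p a x := H_mono (by linarith)
    have h2 := haA x
    linarith
  have hAcl : IsClosed A := by
    have : A = ⋂ x : E, {a | fr p a x ≤ u x} := by
      ext a; simp [hA]
    rw [this]
    refine isClosed_iInter fun x => isClosed_le ?_ continuous_const
    unfold fr; fun_prop
  obtain ⟨a, ha⟩ : ∃ a, a = sSup A := ⟨_, rfl⟩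
  have haA : a ∈ A := by rw [ha]; exact hAcl.csSup_mem ⟨_, hAne⟩ hAbdd
  have haub : ∀ b ∈ A, b ≤ a := fun b hb => by rw [ha]; exact le_csSup hAbdd hb
  set v : E → ℝ := fr p a with hv
  have hvs : IsACSolution v := fr_sol p a
  have hvu : ∀ x, v x ≤ u x := haA
  refine ⟨a, haA, ?_⟩
  by_cases hstrict : ∃ x₁, u x₁ ≤ v x₁
  · left
    obtain ⟨x₁, hx₁⟩ := hstrict
    intro x
    by_contra hne
    have hd : 0 < |u x - v x| := abs_pos.2 (sub_ne_zero.2 hne)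
    obtain ⟨δ, hδ, h⟩ := diff_small hu hvs hvu hd (R := dist x x₁ + 1) (by positivity)
    have := (h x₁ (by linarith) x (by rw [Metric.mem_closedBall]; linarith)).1
    exact lt_irrefl _ this
  right
  push Not at hstrict
  refine ⟨hstrict, ?_⟩
  set L : ℝ := max (K + 1) (a + 1 - T) with hL
  have hL1 : K + 1 ≤ L := le_max_left _ _
  have hL2 : a + 1 - T ≤ L := le_max_right _ _
  have hKpos : 0 < K := by positivity
  have hLpos : 0 < L := by linarith
  have hseq : ∀ δ > 0, ∃ x : E, |x p| ≤ L ∧ u x - v x < δ := by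
    intro δ hδ
    by_contra hcon
    push Not at hcon
    set s := min δ 1 with hs
    have hs0 : 0 < s := lt_min hδ one_pos
    have hs1 : s ≤ 1 := min_le_right _ _
    have hsδ : s ≤ δ := min_le_left _ _
    have hmem : a + s ∈ A := by
      intro x
      refine comparison hu (fr_sol p _) (fun x hx => ?_) x
      by_cases h1 : x p ≤ -K - 1
      · exact Or.inl (hlow x h1)
      · right
        by_cases h2 : x p ≤ L
        · exfalso
          have h3 := hcon x (abs_le.2 ⟨by linarith, h2⟩)
          have h4 : fr p (a + s) x ≤ v x + s := by
            have := H_lip (t := -(x p) + a) hs0.le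
            rw [hv]; unfold fr; rw [← add_assoc]; exact this
          linarith
        · exact hfrT _ _ (by linarith)
    have := haub _ hmem
    linarith
  choose X hX using fun k : ℕ => hseq (1 / ((k:ℝ) + 1)) (by positivity)
  have hpv : ∀ y x : E, y p = 0 → v (x + y) = v x := by
    intro y x hy
    simp [hv, fr, hy]
  set Y : ℕ → E := fun k => X k - (X k p) • ev p with hY
  have hYp : ∀ k, Y k p = 0 := fun k => by simp [hY]
  have hYX : ∀ k, ‖Y k - X k‖ ≤ L := fun k => by
    have : Y k - X k = -((X k p) • ev p) := by simp only [hY]; abel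
    rw [this, norm_neg, norm_smul]
    simpa using (hX k).1
  have huc : Continuous u := hu.1.continuous
  have hvc : Continuous v := hvs.1.continuous
  have hinv : ∀ δ > 0, ∀ᶠ k : ℕ in atTop, 1 / ((k:ℝ) + 1) < δ := fun δ hδ =>
    tendsto_one_div_add_atTop_nhds_zero_nat.eventually (gt_mem_nhds hδ)
  have small : ∀ ε > 0, ∀ R > 0, ∀ᶠ k in atTop, ∀ x ∈ Metric.closedBall (0:E) R,
      |u (x + Y k) - v (x + Y k)| < ε ∧ ‖fderiv ℝ (fun y => u y - v y) (x + Y k)‖ < ε ∧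
      ‖fderiv ℝ (fderiv ℝ (fun y => u y - v y)) (x + Y k)‖ < ε := by
    intro ε hε R hR
    obtain ⟨δ, hδ, h⟩ := diff_small hu hvs hvu hε (R := R + L) (by positivity)
    filter_upwards [hinv δ hδ] with k hk x hx
    refine h (X k) ((hX k).2.trans hk) _ ?_
    rw [mem_closedBall_iff_norm] at hx ⊢
    have e : x + Y k - X k = (x - 0) + (Y k - X k) := by abel
    rw [e]
    exact (norm_add_le _ _).trans (add_le_add hx (hYX k))
  have hwC : ContDiff ℝ 2 u := hu.1
  have hud : Differentiable ℝ u := hu.1.differentiable (by norm_num)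
  have hvd : Differentiable ℝ v := hvs.1.differentiable (by norm_num)
  have hud2 : Differentiable ℝ (fderiv ℝ u) :=
    (hu.1.fderiv_right (m := 1) (by norm_num)).differentiable (by norm_num)
  have hvd2 : Differentiable ℝ (fderiv ℝ v) :=
    (hvs.1.fderiv_right (m := 1) (by norm_num)).differentiable (by norm_num)
  have f1 : fderiv ℝ (fun y => u y - v y) = fun y => fderiv ℝ u y - fderiv ℝ v y := by
    ext1 y; exact fderiv_fun_sub (hud y) (hvd y)
  have f2 : ∀ y, fderiv ℝ (fderiv ℝ (fun y => u y - v y)) y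
      = fderiv ℝ (fderiv ℝ u) y - fderiv ℝ (fderiv ℝ v) y := by
    intro y; rw [f1]; exact fderiv_fun_sub (hud2 y) (hvd2 y)
  have g1 : ∀ y : E, fderiv ℝ (fun z => u (z + y)) = fun x => fderiv ℝ u (x + y) := by
    intro y; ext1 x; exact fderiv_comp_add_right y
  have g2 : ∀ y x : E, fderiv ℝ (fderiv ℝ (fun z => u (z + y))) x
      = fderiv ℝ (fderiv ℝ u) (x + y) := by
    intro y x; rw [g1]; exact fderiv_comp_add_right y
  have k1 : ∀ y : E, y p = 0 → ∀ x, fderiv ℝ v (x + y) = fderiv ℝ v x := by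
    intro y hy x
    rw [← fderiv_comp_add_right]
    congr 1
    ext1 z; exact hpv y z hy
  have k2 : ∀ y : E, y p = 0 → ∀ x, fderiv ℝ (fderiv ℝ v) (x + y) = fderiv ℝ (fderiv ℝ v) x := by
    intro y hy x
    rw [← fderiv_comp_add_right]
    congr 1
    ext1 z; exact k1 y hy z
  refine ⟨Y, hYp, ?_, ?_, ?_, ?_⟩
  · rw [tendsto_atTop]
    intro B
    set C := Metric.closedBall (0:E) (|B| + L) with hC
    have hCne : (0:E) ∈ C := Metric.mem_closedBall_self (by positivity)
    obtain ⟨x, hx, hmin⟩ := (isCompact_closedBall (0:E) (|B| + L)).exists_isMinOn ⟨0, hCne⟩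
      (huc.sub hvc).continuousOn
    filter_upwards [hinv (u x - v x) (sub_pos.2 (hstrict x))] with k hk
    by_contra hB
    push Not at hB
    have hin : X k ∈ C := by
      rw [hC, mem_closedBall_iff_norm]
      have e : X k - 0 = Y k - (Y k - X k) := by abel
      rw [e]
      refine (norm_sub_le _ _).trans (add_le_add (hB.le.trans (le_abs_self B)) (hYX k))
    have h1 : u x - v x ≤ u (X k) - v (X k) := hmin hin
    have h2 := (hX k).2
    linarith
  · refine tlu_of fun ε hε R hR => ?_
    filter_upwards [small ε hε R hR] with k hk x hx
    have := (hk x hx).1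
    rw [hpv _ _ (hYp k)] at this
    rw [dist_comm, Real.dist_eq]; exact this
  · refine tlu_of fun ε hε R hR => ?_
    filter_upwards [small ε hε R hR] with k hk x hx
    have := (hk x hx).2.1
    rw [f1] at this
    simp only [k1 _ (hYp k)] at this
    rw [dist_comm, dist_eq_norm, g1]; exact this
  · refine tlu_of (X := EuclideanSpace ℝ (Fin n) →L[ℝ] EuclideanSpace ℝ (Fin n) →L[ℝ] ℝ) fun ε hε R hR => ?_
    filter_upwards [small ε hε R hR] with k hk x hx
    have := (hk x hx).2.2
    rw [f2, k2 _ (hYp k)] at this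
    rw [dist_comm, g2]
    have e := dist_eq_norm (fderiv ℝ (fderiv ℝ u) (x + Y k)) (fderiv ℝ (fderiv ℝ v) x)
    rw [← e] at this
    exact this


end ACaux

theorem half_space_above {n : ℕ} (hn1 : 1 ≤ n)
    (u : EuclideanSpace ℝ (Fin n) → ℝ)
    (hu : IsACSolution u) (hnc : ¬ ∃ c : ℝ, ∀ x, u x = c)
    (hpos : ∀ x : EuclideanSpace ℝ (Fin n), x ⟨n - 1, by omega⟩ < 0 → 0 < u x) :
    ∃ a : ℝ,
      (∀ x : EuclideanSpace ℝ (Fin n), H (-(x ⟨n - 1, by omega⟩) + a) ≤ u x) ∧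
      ((∀ x : EuclideanSpace ℝ (Fin n), u x = H (-(x ⟨n - 1, by omega⟩) + a)) ∨
       ((∀ x : EuclideanSpace ℝ (Fin n), H (-(x ⟨n - 1, by omega⟩) + a) < u x) ∧
        ∃ y : ℕ → EuclideanSpace ℝ (Fin n),
          (∀ k, y k ⟨n - 1, by omega⟩ = 0) ∧
          Filter.Tendsto (fun k => ‖y k‖) Filter.atTop Filter.atTop ∧
          TendstoLocallyUniformly (fun k x => u (x + y k))
            (fun x : EuclideanSpace ℝ (Fin n) => H (-(x ⟨n - 1, by omega⟩) + a)) Filter.atTop ∧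
          TendstoLocallyUniformly (fun k x => fderiv ℝ (fun z => u (z + y k)) x)
            (fderiv ℝ (fun x : EuclideanSpace ℝ (Fin n) => H (-(x ⟨n - 1, by omega⟩) + a)))
            Filter.atTop ∧
          TendstoLocallyUniformly
            (fun k x => fderiv ℝ (fderiv ℝ (fun z => u (z + y k))) x)
            (fderiv ℝ (fderiv ℝ
              (fun x : EuclideanSpace ℝ (Fin n) => H (-(x ⟨n - 1, by omega⟩) + a))))
            Filter.atTop)) := by
  exact ACaux.main_aux u hu hnc ⟨n - 1, by omega⟩ hpos
end
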